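/- Let d ≥ 1 and let D be a Delone set in ℝ^d (i.e., D is uniformly discrete and relatively dense) that is linearly repetitive. Then there exists a bi-Lipschitz homeomorphism F : ℝ^d → ℝ^d such that F(D) = ℤ^d, where ℤ^d denotes the set of points of ℝ^d all of whose coordinates are integers. -/

import Mathlib

/-- The integer lattice ℤ^d inside `EuclideanSpace ℝ (Fin d)`:
the set of points all of whose coordinates are integers. -/
def intLattice (d : ℕ) : Set (EuclideanSpace ℝ (Fin d)) :=
  {x | ∀ i : Fin d, ∃ n : ℤ, x i = (n : ℝ)}

open Set Function MeasureTheory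
open scoped NNReal ENNReal

/-- The half-open box with lower corner `a` and upper corner `b`. -/
def hbox {d : ℕ} (a b : Fin d → ℝ) : Set (Fin d → ℝ) := Set.pi univ fun i => Ico (a i) (b i)

theorem mem_hbox {d : ℕ} {a b x : Fin d → ℝ} : x ∈ hbox a b ↔ ∀ i, a i ≤ x i ∧ x i < b i := by
  simp [hbox]

/-- Number of points of `D` in a half-open box. -/
noncomputable def boxCount {d : ℕ} (D : Set (Fin d → ℝ)) (a b : Fin d → ℝ) : ℝ :=
  ((D ∩ hbox a b).ncard : ℝ)

/-- Volume of a half-open box. -/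
def boxVol {d : ℕ} (a b : Fin d → ℝ) : ℝ := ∏ i, (b i - a i)

/-- A function of boxes that is additive under cutting by coordinate hyperplanes. -/
def BoxAdditive {d : ℕ} (ψ : (Fin d → ℝ) → (Fin d → ℝ) → ℝ) : Prop :=
  ∀ a b j c, a j ≤ c → c ≤ b j → ψ a b = ψ a (update b j c) + ψ (update a j c) b

theorem boxAdditive_boxVol {d : ℕ} : BoxAdditive (boxVol (d := d)) := by
  intro a b j c _ _
  unfold boxVol
  rw [← Finset.mul_prod_erase _ _ (Finset.mem_univ j),
    ← Finset.mul_prod_erase Finset.univ (fun i => update b j c i - a i) (Finset.mem_univ j),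
    ← Finset.mul_prod_erase Finset.univ (fun i => b i - update a j c i) (Finset.mem_univ j)]
  have h1 : ∏ x ∈ Finset.univ.erase j, (update b j c x - a x)
      = ∏ x ∈ Finset.univ.erase j, (b x - a x) :=
    Finset.prod_congr rfl fun x hx => by rw [update_of_ne (Finset.ne_of_mem_erase hx)]
  have h2 : ∏ x ∈ Finset.univ.erase j, (b x - update a j c x)
      = ∏ x ∈ Finset.univ.erase j, (b x - a x) :=
    Finset.prod_congr rfl fun x hx => by rw [update_of_ne (Finset.ne_of_mem_erase hx)]
  rw [h1, h2, update_self, update_self]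
  ring

theorem boxAdditive_boxCount {d : ℕ} {D : Set (Fin d → ℝ)} (hfin : ∀ a b, (D ∩ hbox a b).Finite) :
    BoxAdditive (boxCount D) := by
  intro a b j c hac hcb
  unfold boxCount
  rw [← Nat.cast_add, ← Set.ncard_union_eq _ (hfin _ _) (hfin _ _)]
  · congr 2
    ext x
    simp only [mem_inter_iff, mem_union, mem_hbox]
    constructor
    · rintro ⟨hx, h⟩
      rcases lt_or_ge (x j) c with hc | hc
      · refine Or.inl ⟨hx, fun i => ⟨(h i).1, ?_⟩⟩
        rcases eq_or_ne i j with rfl | hij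
        · simpa using hc
        · simpa [update_of_ne hij] using (h i).2
      · refine Or.inr ⟨hx, fun i => ⟨?_, (h i).2⟩⟩
        rcases eq_or_ne i j with rfl | hij
        · simpa using hc
        · simpa [update_of_ne hij] using (h i).1
    · rintro (⟨hx, h⟩ | ⟨hx, h⟩)
      · refine ⟨hx, fun i => ⟨(h i).1, (h i).2.trans_le ?_⟩⟩
        rcases eq_or_ne i j with rfl | hij
        · simpa using hcb
        · simp [update_of_ne hij]
      · refine ⟨hx, fun i => ⟨le_trans ?_ (h i).1, (h i).2⟩⟩
        rcases eq_or_ne i j with rfl | hij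
        · simpa using hac
        · simp [update_of_ne hij]
  · rw [Set.disjoint_left]
    rintro x ⟨_, h⟩ ⟨_, h'⟩
    have h1 := (mem_hbox.1 h j).2
    have h2 := (mem_hbox.1 h' j).1
    simp only [update_self] at h1 h2
    exact absurd h1 (not_lt.2 h2)

/-- An additive function that is nonpositive on boxes with sides in `[ℓ, 2ℓ]` is nonpositive on
all boxes with sides at least `ℓ`. -/
theorem BoxAdditive.nonpos_of_sides {d : ℕ} {ψ : (Fin d → ℝ) → (Fin d → ℝ) → ℝ}
    (hψ : BoxAdditive ψ) {ℓ : ℝ} (hℓ : 0 < ℓ)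
    (h : ∀ a b, (∀ i, ℓ ≤ b i - a i) → (∀ i, b i - a i ≤ 2 * ℓ) → ψ a b ≤ 0)
    (a b : Fin d → ℝ) (hab : ∀ i, ℓ ≤ b i - a i) : ψ a b ≤ 0 := by
  suffices H : ∀ s : Finset (Fin d), ∀ a b, (∀ i, ℓ ≤ b i - a i) →
      (∀ i ∉ s, b i - a i ≤ 2 * ℓ) → ψ a b ≤ 0 from
    H Finset.univ a b hab (by simp)
  intro s
  induction s using Finset.induction_on with
  | empty => exact fun a b h1 h2 => h a b h1 fun i => h2 i (by simp)
  | insert j s hj ih =>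
    have key : ∀ n : ℕ, ∀ a b, (∀ i, ℓ ≤ b i - a i) →
        (∀ i ∉ insert j s, b i - a i ≤ 2 * ℓ) → b j - a j ≤ (n + 2) * ℓ → ψ a b ≤ 0 := by
      intro n
      induction n with
      | zero =>
        intro a b h1 h2 h3
        refine ih a b h1 fun i hi => ?_
        rcases eq_or_ne i j with rfl | hij
        · simpa using h3
        · exact h2 i (by simp [hij, hi])
      | succ n ihn =>
        intro a b h1 h2 h3
        by_cases h4 : b j - a j ≤ 2 * ℓ
        · refine ih a b h1 fun i hi => ?_
          rcases eq_or_ne i j with rfl | hij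
          · exact h4
          · exact h2 i (by simp [hij, hi])
        · push Not at h4
          rw [hψ a b j (a j + ℓ) (by linarith) (by linarith)]
          have e1 : ψ a (update b j (a j + ℓ)) ≤ 0 := by
            refine ih _ _ (fun i => ?_) fun i hi => ?_
            · rcases eq_or_ne i j with rfl | hij
              · simp
              · simpa [update_of_ne hij] using h1 i
            · rcases eq_or_ne i j with rfl | hij
              · simp only [update_self]; linarith
              · simpa [update_of_ne hij] using h2 i (by simp [hij, hi])
          have e2 : ψ (update a j (a j + ℓ)) b ≤ 0 := by
            refine ihn _ _ (fun i => ?_) (fun i hi => ?_) ?_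
            · rcases eq_or_ne i j with rfl | hij
              · simp only [update_self]; linarith
              · simpa [update_of_ne hij] using h1 i
            · have hij : i ≠ j := fun hij => hi (by simp [hij])
              simpa [update_of_ne hij] using h2 i hi
            · simp only [update_self]
              push_cast at h3
              linarith
          linarith
    intro a b h1 h2
    obtain ⟨n, hn⟩ := exists_nat_ge ((b j - a j) / ℓ)
    refine key n a b h1 h2 ?_
    rw [div_le_iff₀ hℓ] at hn
    linarith

/-- Passing to a sub-box with margins at least `ℓ` increases an additive function which is
nonpositive on boxes with sides at least `ℓ`. -/
theorem BoxAdditive.le_of_hole {d : ℕ} {ψ : (Fin d → ℝ) → (Fin d → ℝ) → ℝ}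
    (hψ : BoxAdditive ψ) {ℓ : ℝ} (hℓ : 0 < ℓ)
    (h : ∀ a b, (∀ i, ℓ ≤ b i - a i) → ψ a b ≤ 0)
    (a b c e : Fin d → ℝ) (hac : ∀ i, a i + ℓ ≤ c i) (hce : ∀ i, c i + ℓ ≤ e i)
    (heb : ∀ i, e i + ℓ ≤ b i) : ψ a b ≤ ψ c e := by
  suffices H : ∀ s : Finset (Fin d), ψ a b ≤ ψ (s.piecewise c a) (s.piecewise e b) by
    simpa using H Finset.univ
  intro s
  induction s using Finset.induction_on with
  | empty => simp
  | insert j s hj ih =>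
    refine ih.trans ?_
    rw [Finset.piecewise_insert, Finset.piecewise_insert]
    set A := s.piecewise c a with hA
    set B := s.piecewise e b with hB
    have hAj : A j = a j := by simp [hA, hj]
    have hBj : B j = b j := by simp [hB, hj]
    have hAB : ∀ i, ℓ ≤ B i - A i := by
      intro i
      have := hac i; have := hce i; have := heb i
      by_cases hi : i ∈ s
      · simp only [hA, hB, Finset.piecewise_eq_of_mem _ _ _ hi]; linarith
      · simp only [hA, hB, Finset.piecewise_eq_of_notMem _ _ _ hi]; linarith
    have := hac j; have := hce j; have := heb j
    rw [hψ A B j (c j) (by linarith) (by linarith),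
      hψ (update A j (c j)) B j (e j) (by simp only [update_self]; linarith) (by linarith)]
    have e1 : ψ A (update B j (c j)) ≤ 0 := by
      refine h _ _ fun i => ?_
      rcases eq_or_ne i j with rfl | hij
      · simp only [update_self]; linarith
      · simpa [update_of_ne hij] using hAB i
    have e2 : ψ (update (update A j (c j)) j (e j)) B ≤ 0 := by
      refine h _ _ fun i => ?_
      rcases eq_or_ne i j with rfl | hij
      · simp only [update_self]; linarith
      · simpa [update_of_ne hij] using hAB i
    linarith

theorem boxVol_pos {d : ℕ} {a b : Fin d → ℝ} (h : ∀ i, a i < b i) : 0 < boxVol a b :=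
  Finset.prod_pos fun i _ => sub_pos.2 (h i)

theorem boxVol_le_pow {d : ℕ} {a b : Fin d → ℝ} {T : ℝ} (h : ∀ i, a i ≤ b i)
    (h' : ∀ i, b i - a i ≤ T) : boxVol a b ≤ T ^ d := by
  have := Finset.prod_le_prod (s := Finset.univ) (f := fun i => b i - a i) (g := fun _ => T)
    (fun i _ => sub_nonneg.2 (h i)) fun i _ => h' i
  simpa [boxVol] using this

theorem boxVol_cube {d : ℕ} (a : Fin d → ℝ) (L : ℝ) : boxVol a (fun i => a i + L) = L ^ d := by
  simp [boxVol]

theorem BoxAdditive.sub {d : ℕ} {ψ χ : (Fin d → ℝ) → (Fin d → ℝ) → ℝ}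
    (hψ : BoxAdditive ψ) (hχ : BoxAdditive χ) : BoxAdditive fun a b => ψ a b - χ a b := by
  intro a b j c h1 h2
  simp only [hψ a b j c h1 h2, hχ a b j c h1 h2]
  ring

theorem BoxAdditive.const_mul {d : ℕ} {ψ : (Fin d → ℝ) → (Fin d → ℝ) → ℝ}
    (hψ : BoxAdditive ψ) (u : ℝ) : BoxAdditive fun a b => u * ψ a b := by
  intro a b j c h1 h2
  simp only [hψ a b j c h1 h2]
  ring

/-- The point density of `D` in boxes with sides at least `ℓ` lies between `v` and `u`. -/
def DensityBetween {d : ℕ} (D : Set (Fin d → ℝ)) (ℓ v u : ℝ) : Prop :=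
  ∀ a b, (∀ i, ℓ ≤ b i - a i) →
    v * boxVol a b ≤ boxCount D a b ∧ boxCount D a b ≤ u * boxVol a b

theorem DensityBetween.contract {d : ℕ} {D : Set (Fin d → ℝ)} (hfin : ∀ a b, (D ∩ hbox a b).Finite)
    {L M v u : ℝ} (hL : 0 < L) (hM : 1 ≤ M) (hvu : v ≤ u) (y₀ : Fin d → ℝ)
    (hcopy : ∀ a b : Fin d → ℝ, (∀ i, M * L ≤ b i - a i) → ∃ c : Fin d → ℝ, (∀ i, a i + L ≤ c i) ∧
      (∀ i, c i + L + L ≤ b i) ∧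
      boxCount D c (fun i => c i + L) = boxCount D y₀ (fun i => y₀ i + L))
    (h : DensityBetween D L v u) :
    ∃ v' u', v ≤ v' ∧ v' ≤ u' ∧ u' ≤ u ∧ u' - v' = (1 - (1 / (2 * M) ^ d) / 2) * (u - v) ∧
      DensityBetween D (M * L) v' u' := by
  set κ : ℝ := 1 / (2 * M) ^ d with hκ
  have hpow : (1 : ℝ) ≤ (2 * M) ^ d := one_le_pow₀ (by linarith)
  have hκ0 : 0 < κ := by positivity
  have hκ1 : κ ≤ 1 := by rw [hκ, div_le_one (by linarith)]; exact hpow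
  have hML : 0 < M * L := by positivity
  have hLML : L ≤ M * L := by nlinarith
  have hcnt := boxAdditive_boxCount hfin
  have hvol := boxAdditive_boxVol (d := d)
  have hb : ∀ a b : Fin d → ℝ, (∀ i, M * L ≤ b i - a i) → (∀ i, b i - a i ≤ 2 * (M * L)) →
      κ * boxVol a b ≤ L ^ d := by
    intro a b h1 h2
    have h3 := boxVol_le_pow (a := a) (b := b) (fun i => by linarith [h1 i]) h2
    have h4 : (2 * (M * L)) ^ d = (2 * M) ^ d * L ^ d := by rw [← mul_pow]; ring
    rw [h4] at h3
    rw [hκ, one_div, inv_mul_le_iff₀ (by linarith)]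
    exact h3
  have hprod : 0 ≤ κ * (u - v) := mul_nonneg hκ0.le (by linarith)
  have hprod' : κ * (u - v) ≤ u - v := by nlinarith
  rcases le_total (boxCount D y₀ fun i => y₀ i + L) ((u + v) / 2 * L ^ d) with hm | hm
  · refine ⟨v, u - κ * (u - v) / 2, le_rfl, by linarith, by linarith, by ring, ?_⟩
    intro a b hab
    refine ⟨(h a b fun i => hLML.trans (hab i)).1, ?_⟩
    have := (hcnt.sub (hvol.const_mul (u - κ * (u - v) / 2))).nonpos_of_sides hML ?_ a b hab
    · linarith
    intro a b h1 h2
    obtain ⟨c, hc1, hc2, hc3⟩ := hcopy a b h1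
    have h3 := (hcnt.sub (hvol.const_mul u)).le_of_hole hL
      (fun a b hab => by linarith [(h a b hab).2]) a b c (fun i => c i + L) hc1
      (fun i => le_rfl) hc2
    simp only [hc3, boxVol_cube] at h3
    have h4 := hb a b h1 h2
    nlinarith
  · refine ⟨v + κ * (u - v) / 2, u, by linarith, by linarith, le_rfl, by ring, ?_⟩
    intro a b hab
    refine ⟨?_, (h a b fun i => hLML.trans (hab i)).2⟩
    have := ((hvol.const_mul (v + κ * (u - v) / 2)).sub hcnt).nonpos_of_sides hML ?_ a b hab
    · linarith
    intro a b h1 h2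
    obtain ⟨c, hc1, hc2, hc3⟩ := hcopy a b h1
    have h3 := ((hvol.const_mul v).sub hcnt).le_of_hole hL
      (fun a b hab => by linarith [(h a b hab).1]) a b c (fun i => c i + L) hc1
      (fun i => le_rfl) hc2
    simp only [hc3, boxVol_cube] at h3
    have h4 := hb a b h1 h2
    nlinarith

theorem DensityBetween.mono {d : ℕ} {D : Set (Fin d → ℝ)} {ℓ ℓ' v u : ℝ} (h : ℓ ≤ ℓ')
    (hD : DensityBetween D ℓ v u) : DensityBetween D ℓ' v u :=
  fun a b hab => hD a b fun i => h.trans (hab i)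

theorem exists_pow_ge {q : ℝ} (hq1 : q < 1) {m : ℕ} (hm : 0 < m) :
    ∃ s : ℝ, 0 < s ∧ s < 1 ∧ q ≤ s ^ m := by
  wlog hq0 : 0 < q generalizing q
  · obtain ⟨s, h1, h2, h3⟩ := this (q := 1 / 2) (by norm_num) (by norm_num)
    exact ⟨s, h1, h2, by linarith⟩
  refine ⟨q ^ ((1 : ℝ) / m), by positivity, ?_, ?_⟩
  · exact Real.rpow_lt_one hq0.le hq1 (by positivity)
  · rw [← Real.rpow_natCast, ← Real.rpow_mul hq0.le]
    field_simp
    simp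

/-- Geometric decay of the discrepancy from a recurrence property for cubes. -/
theorem exists_density_of_copy {d : ℕ} {D : Set (Fin d → ℝ)}
    (hfin : ∀ a b, (D ∩ hbox a b).Finite) {n₀ m : ℕ} (hm : 0 < m) {v₀ u₀ : ℝ} (hv₀ : 0 < v₀)
    (hvu : v₀ ≤ u₀) (h₀ : DensityBetween D (2 ^ n₀) v₀ u₀)
    (hcopy : ∀ L : ℝ, 1 ≤ L → ∀ y₀ a b : Fin d → ℝ, (∀ i, 2 ^ m * L ≤ b i - a i) →
      ∃ c : Fin d → ℝ, (∀ i, a i + L ≤ c i) ∧ (∀ i, c i + L + L ≤ b i) ∧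
      boxCount D c (fun i => c i + L) = boxCount D y₀ (fun i => y₀ i + L)) :
    ∃ α A s : ℝ, 0 < α ∧ 0 ≤ A ∧ 0 < s ∧ s < 1 ∧ ∀ n, n₀ ≤ n → ∀ a b : Fin d → ℝ,
      (∀ i, 2 ^ n ≤ b i - a i) → |boxCount D a b - α * boxVol a b| ≤ A * s ^ n * boxVol a b := by
  set q : ℝ := 1 - (1 / (2 * (2 : ℝ) ^ m) ^ d) / 2 with hq
  have hq1 : q < 1 := by
    have : (0 : ℝ) < (1 / (2 * (2 : ℝ) ^ m) ^ d) / 2 := by positivity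
    linarith
  obtain ⟨s, hs0, hs1, hqs⟩ := exists_pow_ge hq1 hm
  have step : ∀ (k : ℕ) (p : ℝ × ℝ), p.1 ≤ p.2 → DensityBetween D (2 ^ (n₀ + m * k)) p.1 p.2 →
      ∃ p' : ℝ × ℝ, p.1 ≤ p'.1 ∧ p'.1 ≤ p'.2 ∧ p'.2 ≤ p.2 ∧ p'.2 - p'.1 ≤ s ^ m * (p.2 - p.1) ∧
        DensityBetween D (2 ^ (n₀ + m * (k + 1))) p'.1 p'.2 := by
    intro k p hp hD
    obtain ⟨v', u', h1, h2, h3, h4, h5⟩ := DensityBetween.contract hfin (by positivity)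
      (one_le_pow₀ (by norm_num : (1 : ℝ) ≤ 2)) hp 0
      (hcopy (2 ^ (n₀ + m * k)) (one_le_pow₀ (by norm_num)) 0) hD
    refine ⟨(v', u'), h1, h2, h3, ?_, ?_⟩
    · simp only [h4]
      exact mul_le_mul_of_nonneg_right hqs (by linarith)
    · rw [← pow_add] at h5
      convert h5 using 2
      ring
  choose! f hf using step
  let P : ℕ → ℝ × ℝ := fun k => Nat.rec (v₀, u₀) (fun k p => f k p) k
  have hP : ∀ k, (P k).1 ≤ (P k).2 ∧ DensityBetween D (2 ^ (n₀ + m * k)) (P k).1 (P k).2 := by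
    intro k
    induction k with
    | zero => exact ⟨hvu, h₀⟩
    | succ k ih =>
      have := hf k (P k) ih.1 ih.2
      exact ⟨this.2.1, this.2.2.2.2⟩
  have hstep := fun k => hf k (P k) (hP k).1 (hP k).2
  have hmono : Monotone fun k => (P k).1 := monotone_nat_of_le_succ fun k => (hstep k).1
  have hanti : Antitone fun k => (P k).2 := antitone_nat_of_succ_le fun k => (hstep k).2.2.1
  have hwidth : ∀ k, (P k).2 - (P k).1 ≤ (s ^ m) ^ k * (u₀ - v₀) := by
    intro k
    induction k with
    | zero => simp [P]
    | succ k ih =>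
      refine (hstep k).2.2.2.1.trans ?_
      rw [pow_succ', mul_assoc]
      exact mul_le_mul_of_nonneg_left ih (by positivity)
  have hcross : ∀ j k, (P j).1 ≤ (P k).2 := fun j k =>
    (hmono (le_max_left j k)).trans ((hP _).1.trans (hanti (le_max_right j k)))
  set α := ⨆ k, (P k).1 with hα
  have hα1 : ∀ k, (P k).1 ≤ α := fun k => le_ciSup ⟨u₀, by rintro _ ⟨j, rfl⟩; exact hcross j 0⟩ k
  have hα2 : ∀ k, α ≤ (P k).2 := fun k => ciSup_le fun j => hcross j k
  refine ⟨α, (u₀ - v₀) / s ^ (n₀ + m), s, hv₀.trans_le (hα1 0), ?_, hs0, hs1, ?_⟩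
  · exact div_nonneg (by linarith) (by positivity)
  intro n hn a b hab
  set k := (n - n₀) / m with hk
  have hk1 : n₀ + m * k ≤ n := by
    have := Nat.mul_div_le (n - n₀) m
    rw [← hk] at this
    omega
  have hk2 : n ≤ m * k + (n₀ + m) := by
    have := Nat.lt_mul_div_succ (n - n₀) hm
    rw [← hk, mul_add, mul_one] at this
    omega
  have h1 := (hP k).2 a b fun i => (pow_le_pow_right₀ (by norm_num) hk1).trans (hab i)
  have hV : 0 ≤ boxVol a b := (boxVol_pos fun i => by
    have := hab i
    have : (0 : ℝ) < 2 ^ n := by positivity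
    linarith).le
  have h2 : (P k).2 - (P k).1 ≤ (u₀ - v₀) / s ^ (n₀ + m) * s ^ n := by
    refine (hwidth k).trans ?_
    rw [← pow_mul, div_mul_eq_mul_div, le_div_iff₀ (by positivity), mul_right_comm, ← pow_add,
      mul_comm]
    exact mul_le_mul_of_nonneg_left (pow_le_pow_of_le_one hs0.le hs1.le hk2) (by linarith)
  have h3 := hα1 k
  have h4 := hα2 k
  rw [abs_le]
  constructor <;> nlinarith

/-- Uniform discreteness in terms of the sup distance. -/
def SeparatedBy {d : ℕ} (r : ℝ) (D : Set (Fin d → ℝ)) : Prop :=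
  ∀ x ∈ D, ∀ y ∈ D, x ≠ y → r ≤ dist x y

theorem SeparatedBy.exists_card_bound {d : ℕ} {r : ℝ} {D : Set (Fin d → ℝ)} (hr : 0 < r)
    (hD : SeparatedBy r D) (T : ℝ) :
    ∃ B : ℕ, ∀ a b : Fin d → ℝ, (∀ i, b i - a i ≤ T) →
      (D ∩ hbox a b).Finite ∧ (D ∩ hbox a b).ncard ≤ B := by
  set N : ℕ := ⌊T / (r / 2)⌋₊ + 1 with hN
  let t : Set (Fin d → ℕ) := Set.pi univ fun _ => Set.Iio N
  have ht : t.Finite := Set.Finite.pi fun _ => Set.finite_Iio N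
  refine ⟨t.ncard, fun a b hab => ?_⟩
  let f : (Fin d → ℝ) → (Fin d → ℕ) := fun x i => ⌊(x i - a i) / (r / 2)⌋₊
  have hmaps : Set.MapsTo f (D ∩ hbox a b) t := by
    rintro x ⟨_, hx⟩ i _
    have h1 := mem_hbox.1 hx i
    have h2 := hab i
    refine Nat.lt_succ_of_le (Nat.floor_le_floor ?_)
    gcongr
    linarith
  have hinj : Set.InjOn f (D ∩ hbox a b) := by
    rintro x ⟨hxD, hx⟩ y ⟨hyD, hy⟩ hxy
    by_contra hne
    refine absurd (hD x hxD y hyD hne) (not_le.2 ?_)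
    refine lt_of_le_of_lt ((dist_pi_le_iff (half_pos hr).le).2 fun i => ?_) (half_lt_self hr)
    have h1 := (mem_hbox.1 hx i).1
    have h2 := (mem_hbox.1 hy i).1
    have e : ⌊(x i - a i) / (r / 2)⌋₊ = ⌊(y i - a i) / (r / 2)⌋₊ := congrFun hxy i
    have f1 := Nat.floor_le (a := (x i - a i) / (r / 2)) (div_nonneg (by linarith) (by linarith))
    have f2 := Nat.lt_floor_add_one ((x i - a i) / (r / 2))
    have f3 := Nat.floor_le (a := (y i - a i) / (r / 2)) (div_nonneg (by linarith) (by linarith))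
    have f4 := Nat.lt_floor_add_one ((y i - a i) / (r / 2))
    rw [e] at f1 f2
    have hr2 : 0 < r / 2 := by linarith
    rw [le_div_iff₀ hr2] at f1 f3
    rw [div_lt_iff₀ hr2] at f2 f4
    rw [Real.dist_eq, abs_le]
    constructor <;> nlinarith
  exact ⟨Set.Finite.of_injOn hmaps hinj ht, Set.ncard_le_ncard_of_injOn f hmaps hinj ht⟩

theorem SeparatedBy.finite_inter_hbox {d : ℕ} {r : ℝ} {D : Set (Fin d → ℝ)} (hr : 0 < r)
    (hD : SeparatedBy r D) (a b : Fin d → ℝ) : (D ∩ hbox a b).Finite := by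
  obtain ⟨B, hB⟩ := hD.exists_card_bound hr (∑ i, |b i - a i|)
  exact (hB a b fun i => (le_abs_self _).trans
    (Finset.single_le_sum (f := fun i => |b i - a i|) (fun _ _ => abs_nonneg _)
      (Finset.mem_univ i))).1

theorem exists_densityBetween {d : ℕ} {r R : ℝ} {D : Set (Fin d → ℝ)} (hr : 0 < r)
    (hD : SeparatedBy r D) (hR : ∀ x, ∃ y ∈ D, dist x y ≤ R) :
    ∃ (n₀ : ℕ) (v₀ u₀ : ℝ), 0 < v₀ ∧ v₀ ≤ u₀ ∧ DensityBetween D (2 ^ n₀) v₀ u₀ := by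
  obtain ⟨n₀, hn₀⟩ := pow_unbounded_of_one_lt (2 * R) (one_lt_two : (1 : ℝ) < 2)
  have hfin := hD.finite_inter_hbox hr
  set ℓ : ℝ := 2 ^ n₀ with hℓ
  have hℓ0 : 0 < ℓ := by positivity
  obtain ⟨B, hB⟩ := hD.exists_card_bound hr (2 * ℓ)
  have hcnt := boxAdditive_boxCount hfin
  have hvol := boxAdditive_boxVol (d := d)
  refine ⟨n₀, 1 / (2 * ℓ) ^ d, (B + 1) / ℓ ^ d, by positivity, ?_, ?_⟩
  · refine div_le_div₀ (by positivity) ?_ (by positivity) ?_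
    · have : (0 : ℝ) ≤ B := Nat.cast_nonneg _
      linarith
    · gcongr; linarith
  intro a b hab
  constructor
  · have := ((hvol.const_mul (1 / (2 * ℓ) ^ d)).sub hcnt).nonpos_of_sides hℓ0 ?_ a b hab
    · linarith
    intro a b h1 h2
    have h3 := boxVol_le_pow (a := a) (b := b) (fun i => by linarith [h1 i]) h2
    obtain ⟨y, hyD, hy⟩ := hR fun i => (a i + b i) / 2
    have hR0 : 0 ≤ R := dist_nonneg.trans hy
    rw [dist_pi_le_iff hR0] at hy
    have h4 : 0 < (D ∩ hbox a b).ncard := by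
      rw [Set.ncard_pos (hfin a b)]
      refine ⟨y, hyD, mem_hbox.2 fun i => ?_⟩
      have := abs_le.1 (hy i)
      have := h1 i
      constructor <;> linarith
    have h5 : (1 : ℝ) ≤ boxCount D a b := by
      unfold boxCount
      exact_mod_cast h4
    have h6 : 1 / (2 * ℓ) ^ d * boxVol a b ≤ 1 := by
      rw [one_div, inv_mul_le_iff₀ (by positivity), mul_one]
      exact h3
    linarith
  · have := (hcnt.sub (hvol.const_mul ((B + 1) / ℓ ^ d))).nonpos_of_sides hℓ0 ?_ a b hab
    · linarith
    intro a b h1 h2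
    have h3 : ℓ ^ d ≤ boxVol a b := by
      have := Finset.prod_le_prod (s := Finset.univ) (f := fun _ : Fin d => ℓ)
        (g := fun i => b i - a i) (fun i _ => hℓ0.le) fun i _ => h1 i
      simpa [boxVol] using this
    have h4 : boxCount D a b ≤ B := by
      unfold boxCount
      exact_mod_cast (hB a b h2).2
    have h5 : (B + 1 : ℝ) ≤ (B + 1) / ℓ ^ d * boxVol a b := by
      rw [div_mul_eq_mul_div, le_div_iff₀ (by positivity)]
      exact mul_le_mul_of_nonneg_left h3 (by positivity)
    linarith

/-- Linear repetitivity for patches in cubes. -/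
def CubeRepetitive {d : ℕ} (C : ℝ) (D : Set (Fin d → ℝ)) : Prop :=
  ∀ L : ℝ, 1 ≤ L → ∀ y₀ y : Fin d → ℝ, ∃ t : Fin d → ℝ,
    (∀ p ∈ hbox y₀ (fun i => y₀ i + L), p ∈ D ↔ t + p ∈ D) ∧ dist (t + y₀) y ≤ C * L

theorem CubeRepetitive.exists_copy {d : ℕ} {C : ℝ} {D : Set (Fin d → ℝ)} (h : CubeRepetitive C D)
    {N L : ℝ} (hN : 2 * C + 4 ≤ N) (hL : 1 ≤ L) (y₀ a b : Fin d → ℝ)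
    (hab : ∀ i, N * L ≤ b i - a i) : ∃ c : Fin d → ℝ, (∀ i, a i + L ≤ c i) ∧
      (∀ i, c i + L + L ≤ b i) ∧
      boxCount D c (fun i => c i + L) = boxCount D y₀ (fun i => y₀ i + L) := by
  obtain ⟨t, ht, hd⟩ := h L hL y₀ fun i => (a i + b i) / 2
  rw [dist_pi_le_iff (dist_nonneg.trans hd)] at hd
  have hNL : (2 * C + 4) * L ≤ N * L := by gcongr
  refine ⟨t + y₀, fun i => ?_, fun i => ?_, ?_⟩
  · have := (abs_le.1 (hd i)).1
    have := hab i
    linarith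
  · have := (abs_le.1 (hd i)).2
    have := hab i
    linarith
  · unfold boxCount
    rw [← Set.ncard_image_of_injective (D ∩ hbox y₀ _) (add_right_injective t)]
    congr 2
    ext x
    simp only [mem_inter_iff, mem_image, mem_hbox, Pi.add_apply]
    constructor
    · rintro ⟨hx, hb⟩
      have hb' : x - t ∈ hbox y₀ fun i => y₀ i + L := mem_hbox.2 fun i => by
        have := hb i
        simp only [Pi.sub_apply]
        constructor <;> linarith
      refine ⟨x - t, ⟨(ht _ hb').2 (by simpa using hx), mem_hbox.1 hb'⟩, by simp⟩
    · rintro ⟨p, ⟨hp, hb⟩, rfl⟩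
      refine ⟨(ht p (mem_hbox.2 hb)).1 hp, fun i => ?_⟩
      have := hb i
      simp only [Pi.add_apply]
      constructor <;> linarith

/-- Linearly repetitive Delone sets have a density, with discrepancy decaying geometrically along
dyadic scales. -/
theorem exists_density {d : ℕ} {r R C : ℝ} {D : Set (Fin d → ℝ)} (hr : 0 < r)
    (hD : SeparatedBy r D) (hR : ∀ x, ∃ y ∈ D, dist x y ≤ R) (hC : CubeRepetitive C D) :
    ∃ (n₀ : ℕ) (α A s : ℝ), 0 < α ∧ 0 ≤ A ∧ 0 < s ∧ s < 1 ∧ ∀ n, n₀ ≤ n → ∀ a b : Fin d → ℝ,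
      (∀ i, 2 ^ n ≤ b i - a i) → |boxCount D a b - α * boxVol a b| ≤ A * s ^ n * boxVol a b := by
  obtain ⟨n₀, v₀, u₀, hv₀, hvu, h₀⟩ := exists_densityBetween hr hD hR
  obtain ⟨m, hm⟩ := pow_unbounded_of_one_lt (2 * C + 4) (one_lt_two : (1 : ℝ) < 2)
  refine ⟨n₀, exists_density_of_copy (hD.finite_inter_hbox hr) (Nat.succ_pos m) hv₀ hvu h₀
    fun L hL y₀ a b hab => hC.exists_copy ?_ hL y₀ a b hab⟩
  rw [pow_succ]
  have : (0 : ℝ) < 2 ^ m := by positivity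
  linarith

/-- A bijection which is `K`-Lipschitz together with its inverse. -/
def IsBiLip {E : Type*} [PseudoEMetricSpace E] (K : ℝ≥0) (e : E ≃ E) : Prop :=
  LipschitzWith K e ∧ LipschitzWith K e.symm

theorem IsBiLip.trans {E : Type*} [PseudoEMetricSpace E] {K K' : ℝ≥0} {e e' : E ≃ E}
    (h : IsBiLip K e) (h' : IsBiLip K' e') : IsBiLip (K * K') (e.trans e') :=
  ⟨mul_comm K K' ▸ h'.1.comp h.1, h.2.comp h'.2⟩

theorem IsBiLip.symm {E : Type*} [PseudoEMetricSpace E] {K : ℝ≥0} {e : E ≃ E}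
    (h : IsBiLip K e) : IsBiLip K e.symm :=
  ⟨h.2, h.1⟩

theorem IsBiLip.mono {E : Type*} [PseudoEMetricSpace E] {K K' : ℝ≥0} {e : E ≃ E}
    (h : IsBiLip K e) (hK : K ≤ K') : IsBiLip K' e :=
  ⟨h.1.weaken hK, h.2.weaken hK⟩

theorem IsBiLip.refl {E : Type*} [PseudoEMetricSpace E] : IsBiLip 1 (Equiv.refl E) :=
  ⟨LipschitzWith.id, LipschitzWith.id⟩

/-- A perturbation of the identity by a map with Lipschitz constant `η ≤ 1/2` is a bi-Lipschitz
homeomorphism. -/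
theorem exists_equiv_id_add {E : Type*} [NormedAddCommGroup E] [CompleteSpace E] {g : E → E}
    {η : ℝ≥0} (hη : (η : ℝ) ≤ 1 / 2) (hg : LipschitzWith η g) :
    ∃ e : E ≃ E, (∀ x, e x = x + g x) ∧ IsBiLip (1 + 2 * η) e := by
  have hlow : ∀ x y, (1 - η : ℝ) * dist x y ≤ dist (x + g x) (y + g y) := by
    intro x y
    have h1 := hg.dist_le_mul x y
    have h2 : x - y = (x + g x - (y + g y)) - (g x - g y) := by abel
    have h3 := norm_sub_le (x + g x - (y + g y)) (g x - g y)
    rw [← h2] at h3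
    simp only [dist_eq_norm] at *
    linarith
  have hpos : (0 : ℝ) < 1 - η := by linarith
  have hinj : Injective fun x => x + g x := by
    intro x y hxy
    have h1 := hlow x y
    simp only at hxy
    rw [hxy, dist_self] at h1
    have h2 := dist_nonneg (x := x) (y := y)
    exact dist_le_zero.1 (by nlinarith)
  have hsurj : Surjective fun x => x + g x := by
    intro y
    have hc : ContractingWith η fun x => y - g x := by
      refine ⟨?_, LipschitzWith.of_dist_le_mul fun a b => ?_⟩
      · have : (η : ℝ) < 1 := by linarith
        exact_mod_cast this
      · rw [dist_sub_left]
        exact hg.dist_le_mul a b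
    have : Nonempty E := ⟨0⟩
    obtain ⟨x, hx⟩ : ∃ x, y - g x = x := ⟨_, hc.fixedPoint_isFixedPt⟩
    exact ⟨x, eq_sub_iff_add_eq.1 hx.symm⟩
  have hbij : Bijective fun x => x + g x := ⟨hinj, hsurj⟩
  refine ⟨Equiv.ofBijective _ hbij, fun x => rfl, ?_, ?_⟩
  · refine LipschitzWith.of_dist_le_mul fun x y => ?_
    have h1 := hg.dist_le_mul x y
    have h2 := dist_add_add_le x (g x) y (g y)
    have h3 := dist_nonneg (x := x) (y := y)
    have h4 : (0 : ℝ) ≤ η := η.2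
    change dist (x + g x) (y + g y) ≤ _
    push_cast
    nlinarith
  · refine LipschitzWith.of_dist_le_mul fun x y => ?_
    set e := Equiv.ofBijective _ hbij with he
    have h1 := hlow (e.symm x) (e.symm y)
    have hx : ∀ z, e.symm z + g (e.symm z) = z := fun z => e.apply_symm_apply z
    rw [hx, hx] at h1
    have h3 := dist_nonneg (x := x) (y := y)
    have h4 : (0 : ℝ) ≤ η := η.2
    have h5 := dist_nonneg (x := e.symm x) (y := e.symm y)
    push_cast
    have h6 : (1 : ℝ) ≤ (1 + 2 * η) * (1 - η) := by nlinarith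
    calc dist (e.symm x) (e.symm y) ≤ (1 + 2 * η) * (1 - η) * dist (e.symm x) (e.symm y) :=
          le_mul_of_one_le_left h5 h6
      _ = (1 + 2 * η) * ((1 - η) * dist (e.symm x) (e.symm y)) := by ring
      _ ≤ _ := mul_le_mul_of_nonneg_left h1 (by positivity)

/-- Monotone rearrangement on the line. -/
theorem map_withDensity_of_strictMono {a b φ : ℝ → ℝ} (ha : Continuous a) (hb : Continuous b)
    (ha0 : ∀ t, 0 ≤ a t) (hb0 : ∀ t, 0 ≤ b t) (hφ : StrictMono φ) (hs : Surjective φ)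
    (hab : ∀ s t, ∫ τ in s..t, a τ = ∫ τ in φ s..φ t, b τ) :
    Measure.map φ (volume.withDensity fun t => ENNReal.ofReal (a t))
      = volume.withDensity fun t => ENNReal.ofReal (b t) := by
  have key : ∀ f : ℝ → ℝ, Continuous f → (∀ t, 0 ≤ f t) → ∀ s t, s ≤ t →
      (volume.withDensity fun t => ENNReal.ofReal (f t)) (Ioc s t)
        = ENNReal.ofReal (∫ τ in s..t, f τ) := by
    intro f hf hf0 s t hst
    rw [withDensity_apply _ measurableSet_Ioc, intervalIntegral.integral_of_le hst,
      ofReal_integral_eq_lintegral_ofReal]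
    · exact (hf.integrableOn_Icc).mono_set Ioc_subset_Icc_self
    · exact Filter.Eventually.of_forall hf0
  have hmeas : Measurable φ := hφ.monotone.measurable
  have himg : ∀ s t, φ ⁻¹' Ioc (φ s) (φ t) = Ioc s t := by
    intro s t
    ext x
    simp [hφ.lt_iff_lt, hφ.le_iff_le]
  have heq : ∀ s t, s < t → Measure.map φ (volume.withDensity fun t => ENNReal.ofReal (a t))
      (Ioc (φ s) (φ t)) = (volume.withDensity fun t => ENNReal.ofReal (b t)) (Ioc (φ s) (φ t)) := by
    intro s t hst
    rw [Measure.map_apply hmeas measurableSet_Ioc, himg, key a ha ha0 s t hst.le,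
      key b hb hb0 _ _ (hφ hst).le, hab]
  refine Measure.ext_of_Ioc' _ _ ?_ ?_
  · intro x y hxy
    obtain ⟨s, rfl⟩ := hs x
    obtain ⟨t, rfl⟩ := hs y
    rw [heq s t (hφ.lt_iff_lt.1 hxy), key b hb hb0 _ _ hxy.le]
    exact ENNReal.ofReal_ne_top
  · intro x y hxy
    obtain ⟨s, rfl⟩ := hs x
    obtain ⟨t, rfl⟩ := hs y
    exact heq s t (hφ.lt_iff_lt.1 hxy)

theorem update_add_single {d : ℕ} (x : Fin d → ℝ) (j : Fin d) (s t : ℝ) :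
    update x j s + Pi.single j t = update x j (s + t) := by
  ext i
  rcases eq_or_ne i j with rfl | h <;> simp [*]

/-- Monotone rearrangement along lines parallel to a coordinate axis. -/
theorem map_withDensity_of_lines {d : ℕ} {h h' u : (Fin d → ℝ) → ℝ} (j : Fin d)
    (hh : Continuous h) (hh' : Continuous h') (hu : Continuous u) (h0 : ∀ x, 0 ≤ h x)
    (h0' : ∀ x, 0 ≤ h' x)
    (hφ : ∀ x, StrictMono fun t => t + u (update x j t))
    (hs : ∀ x, Surjective fun t => t + u (update x j t))
    (hab : ∀ x s t, ∫ τ in s..t, h (update x j τ)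
      = ∫ τ in (s + u (update x j s))..(t + u (update x j t)), h' (update x j τ)) :
    Measure.map (fun x => x + Pi.single j (u x)) (volume.withDensity fun x => ENNReal.ofReal (h x))
      = volume.withDensity fun x => ENNReal.ofReal (h' x) := by
  have hupd : ∀ x : Fin d → ℝ, Continuous fun t => update x j t := fun x =>
    continuous_const.update j continuous_id
  have hΦ : Measurable fun x : Fin d → ℝ => x + Pi.single j (u x) :=
    (continuous_id.add ((continuous_single j).comp hu)).measurable
  ext B hB
  rw [Measure.map_apply hΦ hB, withDensity_apply _ (hΦ hB), withDensity_apply _ hB,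
    ← lintegral_indicator (hΦ hB), ← lintegral_indicator hB, volume_pi]
  refine lintegral_eq_of_lmarginal_eq {j} ?_ ?_ ?_
  · exact (hh.measurable.ennreal_ofReal).indicator (hΦ hB)
  · exact (hh'.measurable.ennreal_ofReal).indicator hB
  rw [lmarginal_singleton, lmarginal_singleton]
  funext x
  set φ : ℝ → ℝ := fun t => t + u (update x j t) with hφdef
  have hBx : MeasurableSet ((fun t => update x j t) ⁻¹' B) := (hupd x).measurable hB
  have hφm : Measurable φ := (hφ x).monotone.measurable
  have h1 := map_withDensity_of_strictMono (hh.comp (hupd x)) (hh'.comp (hupd x))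
    (fun t => h0 _) (fun t => h0' _) (hφ x) (hs x) (hab x)
  have h2 := congrArg (fun μ => μ ((fun t => update x j t) ⁻¹' B)) h1
  rw [Measure.map_apply hφm hBx, withDensity_apply _ (hφm hBx), withDensity_apply _ hBx,
    ← lintegral_indicator (hφm hBx), ← lintegral_indicator hBx] at h2
  refine Eq.trans (lintegral_congr fun t => ?_) (h2.trans (lintegral_congr fun t => ?_))
  · have hm : update x j t + Pi.single j (u (update x j t)) = update x j (φ t) :=
      update_add_single x j t _
    classical
    simp only [indicator_apply]
    refine if_congr ?_ rfl rfl
    change _ + _ ∈ B ↔ update x j (φ t) ∈ B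
    rw [hm]
  · rfl

theorem mul_abs_sub_le_abs_integral {g : ℝ → ℝ} {m : ℝ} (hg : Continuous g) (hm : ∀ t, m ≤ g t)
    (s t : ℝ) : m * |t - s| ≤ |∫ τ in s..t, g τ| := by
  wlog hst : s ≤ t generalizing s t
  · rw [abs_sub_comm, intervalIntegral.integral_symm, abs_neg]
    exact this t s (le_of_not_ge hst)
  have h1 : ∫ _ in s..t, m ≤ ∫ τ in s..t, g τ :=
    intervalIntegral.integral_mono_on hst (by simp) (hg.intervalIntegrable _ _) fun x _ => hm x
  rw [intervalIntegral.integral_const, smul_eq_mul] at h1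
  rw [abs_of_nonneg (sub_nonneg.2 hst)]
  linarith [le_abs_self (∫ τ in s..t, g τ)]

theorem exists_integral_eq {g : ℝ → ℝ} {m : ℝ} (hg : Continuous g) (hm0 : 0 < m)
    (hm : ∀ t, m ≤ g t) (c : ℝ) : ∃ u, ∫ τ in (0 : ℝ)..u, g τ = c := by
  have hcont : Continuous fun u => ∫ τ in (0 : ℝ)..u, g τ :=
    intervalIntegral.continuous_primitive (fun a b => hg.intervalIntegrable a b) 0
  have hmono : ∀ s t, s ≤ t → m * (t - s) ≤ ∫ τ in s..t, g τ := by
    intro s t hst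
    have h1 : ∫ _ in s..t, m ≤ ∫ τ in s..t, g τ :=
      intervalIntegral.integral_mono_on hst (by simp) (hg.intervalIntegrable _ _) fun x _ => hm x
    rw [intervalIntegral.integral_const, smul_eq_mul] at h1
    linarith
  set b : ℝ := |c| / m with hb
  have hb0 : 0 ≤ b := by positivity
  have hmb : m * b = |c| := by rw [hb]; field_simp
  have h1 := hmono 0 b hb0
  have h2 := hmono (-b) 0 (by linarith)
  rw [intervalIntegral.integral_symm] at h2
  have h3 := intermediate_value_Icc (a := -b) (b := b) (by linarith) hcont.continuousOn
  have hc : c ∈ Icc (∫ τ in (0 : ℝ)..(-b), g τ) (∫ τ in (0 : ℝ)..b, g τ) :=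
    ⟨by nlinarith [neg_abs_le c], by nlinarith [le_abs_self c]⟩
  obtain ⟨u, -, hu⟩ := h3 hc
  exact ⟨u, hu⟩

/-- The three-term average of `h` in the `j`-th direction at scale `L`. -/
noncomputable def lineAverage {d : ℕ} (j : Fin d) (L : ℝ) (h : (Fin d → ℝ) → ℝ)
    (x : Fin d → ℝ) : ℝ :=
  h x / 2 + h (x + Pi.single j (-L)) / 4 + h (x + Pi.single j L) / 4

theorem abs_lineAverage_sub_le {d : ℕ} {j : Fin d} {L α ε : ℝ} {h : (Fin d → ℝ) → ℝ}
    (hb : ∀ x, |h x - α| ≤ ε) (x : Fin d → ℝ) : |lineAverage j L h x - α| ≤ ε := by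
  have h1 := abs_le.1 (hb x)
  have h2 := abs_le.1 (hb (x + Pi.single j (-L)))
  have h3 := abs_le.1 (hb (x + Pi.single j L))
  unfold lineAverage
  exact abs_le.2 ⟨by linarith, by linarith⟩

theorem abs_lineAverage_sub_lineAverage_le {d : ℕ} {j : Fin d} {L c : ℝ} {h : (Fin d → ℝ) → ℝ}
    (hb : ∀ x y, |h x - h y| ≤ c * dist x y) (x y : Fin d → ℝ) :
    |lineAverage j L h x - lineAverage j L h y| ≤ c * dist x y := by
  have h1 := abs_le.1 (hb x y)
  have h2 := abs_le.1 (hb (x + Pi.single j (-L)) (y + Pi.single j (-L)))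
  have h3 := abs_le.1 (hb (x + Pi.single j L) (y + Pi.single j L))
  rw [dist_add_right] at h2 h3
  unfold lineAverage
  exact abs_le.2 ⟨by linarith, by linarith⟩

theorem continuous_of_abs_sub_le {X : Type*} [PseudoMetricSpace X] {h : X → ℝ} {c : ℝ}
    (hc : 0 ≤ c) (hb : ∀ x y, |h x - h y| ≤ c * dist x y) : Continuous h := by
  have : LipschitzWith c.toNNReal h := LipschitzWith.of_dist_le_mul fun x y => by
    rw [Real.dist_eq, Real.coe_toNNReal c hc]
    exact hb x y
  exact this.continuous

/-- Transport along lines realising a three-term average of a density. -/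
theorem exists_map_withDensity_eq_lineAverage {d : ℕ} {h : (Fin d → ℝ) → ℝ} (j : Fin d)
    {α ε c L : ℝ} (hα : 0 < α) (hε : ε ≤ α / 2) (hc : 0 ≤ c) (hL : 0 < L)
    (hb : ∀ x, |h x - α| ≤ ε) (hlip : ∀ x y, |h x - h y| ≤ c * dist x y)
    (hη : 2 * L * c / α ≤ 1 / 2) :
    ∃ e : (Fin d → ℝ) ≃ (Fin d → ℝ), IsBiLip (1 + 2 * (2 * L * c / α).toNNReal) e ∧
      Measure.map e (volume.withDensity fun x => ENNReal.ofReal (h x))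
        = volume.withDensity fun x => ENNReal.ofReal (lineAverage j L h x) := by
  set h' := lineAverage j L h with hh'def
  have hcont : Continuous h := continuous_of_abs_sub_le hc hlip
  have hlip' : ∀ x y, |h' x - h' y| ≤ c * dist x y := abs_lineAverage_sub_lineAverage_le hlip
  have hcont' : Continuous h' := continuous_of_abs_sub_le hc hlip'
  have hb' : ∀ x, |h' x - α| ≤ ε := abs_lineAverage_sub_le hb
  have hsing : Continuous fun t : ℝ => (Pi.single j t : Fin d → ℝ) :=
    continuous_single (A := fun _ : Fin d => ℝ) j
  have hline : ∀ x : Fin d → ℝ, Continuous fun t : ℝ => x + Pi.single j t := fun x =>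
    continuous_const.add hsing
  have hneg : Continuous fun t : ℝ => (Pi.single j (-t) : Fin d → ℝ) := hsing.comp continuous_neg
  have hlow' : ∀ x, α / 2 ≤ h' x := fun x => by linarith [(abs_le.1 (hb' x)).1]
  have hlow : ∀ x, α / 2 ≤ h x := fun x => by linarith [(abs_le.1 (hb x)).1]
  set v : (Fin d → ℝ) → ℝ := fun x =>
    (∫ t in (0 : ℝ)..L, (h (x + Pi.single j (-t)) - h (x + Pi.single j t))) / 4 with hv
  have hvint : ∀ x : Fin d → ℝ, Continuous fun t : ℝ =>
      h (x + Pi.single j (-t)) - h (x + Pi.single j t) := fun x =>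
    (hcont.comp (continuous_const.add hneg)).sub (hcont.comp (hline x))
  have hvb : ∀ x, |v x| ≤ L * ε / 2 := by
    intro x
    have h1 := intervalIntegral.norm_integral_le_of_norm_le_const (a := 0) (b := L) (C := 2 * ε)
      (f := fun t => h (x + Pi.single j (-t)) - h (x + Pi.single j t)) fun t _ => by
        have h1 := abs_le.1 (hb (x + Pi.single j (-t)))
        have h2 := abs_le.1 (hb (x + Pi.single j t))
        rw [Real.norm_eq_abs]
        exact abs_le.2 ⟨by linarith, by linarith⟩
    rw [Real.norm_eq_abs, sub_zero, abs_of_pos hL] at h1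
    rw [hv]
    simp only
    rw [abs_div, abs_of_pos (by norm_num : (0 : ℝ) < 4)]
    linarith
  have hvl : ∀ x y, |v x - v y| ≤ L * c / 2 * dist x y := by
    intro x y
    have h1 := intervalIntegral.norm_integral_le_of_norm_le_const (a := 0) (b := L)
      (C := 2 * (c * dist x y))
      (f := fun t => (h (x + Pi.single j (-t)) - h (x + Pi.single j t))
        - (h (y + Pi.single j (-t)) - h (y + Pi.single j t))) fun t _ => by
        have h1 := abs_le.1 (hlip (x + Pi.single j (-t)) (y + Pi.single j (-t)))
        have h2 := abs_le.1 (hlip (x + Pi.single j t) (y + Pi.single j t))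
        rw [dist_add_right] at h1 h2
        rw [Real.norm_eq_abs]
        exact abs_le.2 ⟨by linarith, by linarith⟩
    rw [intervalIntegral.integral_sub ((hvint x).intervalIntegrable _ _)
      ((hvint y).intervalIntegrable _ _), Real.norm_eq_abs, sub_zero, abs_of_pos hL] at h1
    rw [hv]
    simp only
    rw [← sub_div, abs_div, abs_of_pos (by norm_num : (0 : ℝ) < 4)]
    linarith
  have hex : ∀ x, ∃ u, ∫ t in (0 : ℝ)..u, h' (x + Pi.single j t) = v x := fun x =>
    exists_integral_eq (hcont'.comp (hline x)) (half_pos hα) (fun t => hlow' _) _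
  choose u hu using hex
  have hub : ∀ x, |u x| ≤ L / 2 := by
    intro x
    have h1 := mul_abs_sub_le_abs_integral (hcont'.comp (hline x)) (fun t => hlow' _) 0 (u x)
    simp only [Function.comp_apply] at h1
    rw [hu, sub_zero] at h1
    have h2 := hvb x
    have h3 : α / 2 * |u x| ≤ α / 2 * (L / 2) := by nlinarith
    exact le_of_mul_le_mul_left h3 (half_pos hα)
  have hul : ∀ x y, |u x - u y| ≤ 2 * L * c / α * dist x y := by
    intro x y
    have h1 := mul_abs_sub_le_abs_integral (hcont'.comp (hline x)) (fun t => hlow' _) (u y) (u x)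
    simp only [Function.comp_apply] at h1
    have hI := fun z a b => (hcont'.comp (hline z)).intervalIntegrable (μ := volume) a b
    simp only [Function.comp_def] at hI
    rw [← intervalIntegral.integral_interval_sub_left (hI x 0 _) (hI x 0 _), hu] at h1
    have h2 := intervalIntegral.norm_integral_le_of_norm_le_const (a := 0) (b := u y)
      (C := c * dist x y)
      (f := fun t => h' (x + Pi.single j t) - h' (y + Pi.single j t)) fun t _ => by
        have h1 := hlip' (x + Pi.single j t) (y + Pi.single j t)
        rwa [dist_add_right] at h1
    rw [intervalIntegral.integral_sub (hI x _ _) (hI y _ _), hu, sub_zero, Real.norm_eq_abs] at h2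
    have h3 := hub y
    have h4 := abs_le.1 (hvl x y)
    have h5 : c * dist x y * |u y| ≤ c * dist x y * (L / 2) :=
      mul_le_mul_of_nonneg_left h3 (mul_nonneg hc dist_nonneg)
    have h6 := abs_le.1 h2
    have h7 : |v x - ∫ t in (0 : ℝ)..u y, h' (x + Pi.single j t)| ≤ L * c * dist x y :=
      abs_le.2 ⟨by linarith, by linarith⟩
    have h8 : α / 2 * |u x - u y| ≤ α / 2 * (2 * L * c / α * dist x y) := by
      have : α / 2 * (2 * L * c / α * dist x y) = L * c * dist x y := by field_simp
      linarith
    exact le_of_mul_le_mul_left h8 (half_pos hα)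
  set η := (2 * L * c / α).toNNReal with hηdef
  have hη0 : 0 ≤ 2 * L * c / α := by positivity
  have hηc : (η : ℝ) = 2 * L * c / α := Real.coe_toNNReal _ hη0
  have hη2 : (η : ℝ) ≤ 1 / 2 := hηc ▸ hη
  have hulip : LipschitzWith η u := LipschitzWith.of_dist_le_mul fun x y => by
    rw [Real.dist_eq, hηc]
    exact hul x y
  have hglip : LipschitzWith η fun x => (Pi.single j (u x) : Fin d → ℝ) :=
    LipschitzWith.of_dist_le_mul fun x y => by
      refine le_trans ?_ (hulip.dist_le_mul x y)
      rw [dist_eq_norm, ← Pi.single_sub, Pi.norm_single, dist_eq_norm]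
  obtain ⟨e, he, hbi⟩ := exists_equiv_id_add hη2 hglip
  refine ⟨e, hbi, ?_⟩
  have hefun : (e : (Fin d → ℝ) → (Fin d → ℝ)) = fun x => x + Pi.single j (u x) := funext he
  rw [hefun]
  have hdist : ∀ (x : Fin d → ℝ) s t, dist (update x j s) (update x j t) ≤ dist s t := by
    intro x s t
    refine (dist_pi_le_iff dist_nonneg).2 fun i => ?_
    rcases eq_or_ne i j with rfl | hi <;> simp [*]
  have hulip1 : ∀ x, LipschitzWith η fun t => u (update x j t) := fun x =>
    LipschitzWith.of_dist_le_mul fun s t =>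
      (hulip.dist_le_mul _ _).trans (mul_le_mul_of_nonneg_left (hdist x s t) η.2)
  refine map_withDensity_of_lines j hcont hcont' hulip.continuous
    (fun x => (half_pos hα).le.trans (hlow x)) (fun x => (half_pos hα).le.trans (hlow' x)) ?_ ?_ ?_
  · intro x s t hst
    have h1 := (hulip1 x).dist_le_mul s t
    rw [Real.dist_eq, Real.dist_eq, abs_sub_comm s t, abs_of_pos (sub_pos.2 hst)] at h1
    have h2 := (abs_le.1 h1).2
    have h3 : (0 : ℝ) < t - s := sub_pos.2 hst
    simp only
    nlinarith
  · intro x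
    obtain ⟨e₁, he₁, -⟩ := exists_equiv_id_add hη2 (hulip1 x)
    have : (fun t => t + u (update x j t)) = e₁ := (funext he₁).symm
    rw [this]
    exact e₁.surjective
  · intro x s t
    set f : ℝ → ℝ := fun τ => h (update x j τ) with hf
    have hfc : Continuous f := hcont.comp (continuous_const.update j continuous_id)
    have hfi : ∀ a b, IntervalIntegrable f volume a b := fun a b => hfc.intervalIntegrable a b
    set f' : ℝ → ℝ := fun τ => h' (update x j τ) with hf'
    have hfc' : Continuous f' := hcont'.comp (continuous_const.update j continuous_id)
    have hfi' : ∀ a b, IntervalIntegrable f' volume a b := fun a b => hfc'.intervalIntegrable a b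
    have hrel : ∀ τ, f' τ = f τ / 2 + f (τ + -L) / 4 + f (τ + L) / 4 := by
      intro τ
      simp only [hf, hf', hh'def, lineAverage, update_add_single]
    set H : ℝ → ℝ := fun τ => ∫ σ in (0 : ℝ)..τ, f σ with hH
    have hHs : ∀ a b, ∫ σ in a..b, f σ = H b - H a := fun a b =>
      (intervalIntegral.integral_interval_sub_left (hfi 0 b) (hfi 0 a)).symm
    have hG : ∀ a b, ∫ σ in a..b, f' σ = (H b - H a) / 2 + (H (b + -L) - H (a + -L)) / 4
        + (H (b + L) - H (a + L)) / 4 := by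
      intro a b
      simp only [hrel]
      have i1 : IntervalIntegrable (fun τ => f τ / 2) volume a b :=
        (hfc.div_const 2).intervalIntegrable _ _
      have i2 : IntervalIntegrable (fun τ => f (τ + -L) / 4) volume a b :=
        ((hfc.comp (continuous_add_const (-L))).div_const 4).intervalIntegrable _ _
      have i3 : IntervalIntegrable (fun τ => f (τ + L) / 4) volume a b :=
        ((hfc.comp (continuous_add_const L)).div_const 4).intervalIntegrable _ _
      rw [intervalIntegral.integral_add (i1.add i2) i3, intervalIntegral.integral_add i1 i2]
      simp only [intervalIntegral.integral_div]
      rw [intervalIntegral.integral_comp_add_right, intervalIntegral.integral_comp_add_right,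
        hHs, hHs, hHs]
    have hvH : ∀ a, v (update x j a) = (2 * H a - H (a + -L) - H (a + L)) / 4 := by
      intro a
      simp only [hv, update_add_single]
      have i2 : IntervalIntegrable (fun t => f (a + -t)) volume 0 L :=
        (hfc.comp (continuous_const.add continuous_neg)).intervalIntegrable _ _
      have i3 : IntervalIntegrable (fun t => f (a + t)) volume 0 L :=
        (hfc.comp (continuous_const.add continuous_id)).intervalIntegrable _ _
      have e1 : ∫ t in (0 : ℝ)..L, f (a + -t) = H a - H (a + -L) := by
        simp only [← sub_eq_add_neg]
        rw [intervalIntegral.integral_comp_sub_left, hHs, sub_zero]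
      have e2 : ∫ t in (0 : ℝ)..L, f (a + t) = H (a + L) - H a := by
        rw [intervalIntegral.integral_comp_add_left, hHs, add_zero]
      rw [intervalIntegral.integral_sub i2 i3, e1, e2]
      ring
    have hstep : ∀ a, ∫ σ in a..(a + u (update x j a)), f' σ
        = (2 * H a - H (a + -L) - H (a + L)) / 4 := by
      intro a
      rw [← hvH, ← hu]
      simp only [update_add_single]
      rw [intervalIntegral.integral_comp_add_left (fun σ => h' (update x j σ)), add_zero]
    have h1 : ∫ σ in (s + u (update x j s))..(t + u (update x j t)), f' σ
        = (∫ σ in s..t, f' σ) + (∫ σ in t..(t + u (update x j t)), f' σ)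
          - ∫ σ in s..(s + u (update x j s)), f' σ := by
      rw [intervalIntegral.integral_add_adjacent_intervals (hfi' _ _) (hfi' _ _),
        intervalIntegral.integral_interval_sub_left (hfi' _ _) (hfi' _ _)]
    rw [h1, hstep, hstep, hG, hHs]
    ring

/-- The normalised tent function of half-width `L`. -/
noncomputable def tent (L u : ℝ) : ℝ := max 0 (L - |u|) / L ^ 2

theorem tent_two_mul {L : ℝ} (hL : 0 < L) (u : ℝ) :
    tent (2 * L) u = tent L u / 2 + tent L (u + L) / 4 + tent L (u - L) / 4 := by
  have h : max 0 (2 * L - |u|)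
      = 2 * max 0 (L - |u|) + max 0 (L - |u + L|) + max 0 (L - |u - L|) := by
    rcases abs_cases u with ⟨h1, h1'⟩ | ⟨h1, h1'⟩ <;>
    rcases abs_cases (u + L) with ⟨h2, h2'⟩ | ⟨h2, h2'⟩ <;>
    rcases abs_cases (u - L) with ⟨h3, h3'⟩ | ⟨h3, h3'⟩ <;>
    rcases max_cases 0 (2 * L - |u|) with ⟨h4, h4'⟩ | ⟨h4, h4'⟩ <;>
    rcases max_cases 0 (L - |u|) with ⟨h5, h5'⟩ | ⟨h5, h5'⟩ <;>
    rcases max_cases 0 (L - |u + L|) with ⟨h6, h6'⟩ | ⟨h6, h6'⟩ <;>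
    rcases max_cases 0 (L - |u - L|) with ⟨h7, h7'⟩ | ⟨h7, h7'⟩ <;>
    linarith
  unfold tent
  rw [h]
  field_simp
  ring

theorem tent_eq_zero {L u : ℝ} (h : L ≤ |u|) : tent L u = 0 := by
  unfold tent
  rw [max_eq_left (by linarith), zero_div]

theorem tent_nonneg (L u : ℝ) : 0 ≤ tent L u := by
  unfold tent
  positivity

/-- The point density of `D`, smoothed by a product of tents of half-widths `ℓ i`. -/
noncomputable def pointDensity {d : ℕ} (D : Set (Fin d → ℝ)) (ℓ x : Fin d → ℝ) : ℝ :=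
  ∑ᶠ p ∈ D, ∏ i, tent (ℓ i) (p i - x i)

theorem pointDensity_eq_sum {d : ℕ} {D : Set (Fin d → ℝ)} {ℓ x : Fin d → ℝ}
    {F : Finset (Fin d → ℝ)} (hF : ↑F ⊆ D)
    (h : ∀ p ∈ D, (∀ i, |p i - x i| < ℓ i) → p ∈ F) :
    pointDensity D ℓ x = ∑ p ∈ F, ∏ i, tent (ℓ i) (p i - x i) := by
  refine finsum_mem_eq_sum_of_inter_support_eq _ ?_
  ext p
  simp only [mem_inter_iff, mem_support, Finset.mem_coe]
  refine and_congr_left fun hp => ⟨fun hpD => h p hpD fun i => ?_, fun hpF => hF hpF⟩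
  by_contra hi
  exact hp (Finset.prod_eq_zero (Finset.mem_univ i) (tent_eq_zero (not_lt.1 hi)))

theorem SeparatedBy.exists_finset {d : ℕ} {D : Set (Fin d → ℝ)} {r : ℝ} (hr : 0 < r)
    (hD : SeparatedBy r D) (a b : Fin d → ℝ) :
    ∃ F : Finset (Fin d → ℝ), ↑F ⊆ D ∧ ∀ p, p ∈ F ↔ p ∈ D ∧ p ∈ hbox a b := by
  refine ⟨(SeparatedBy.finite_inter_hbox hr hD a b).toFinset, ?_, ?_⟩
  · simp
  · simp

theorem lineAverage_pointDensity {d : ℕ} {D : Set (Fin d → ℝ)} {r : ℝ} (hr : 0 < r)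
    (hD : SeparatedBy r D) (j : Fin d) (ℓ : Fin d → ℝ) (hℓ : ∀ i, 0 < ℓ i) :
    lineAverage j (ℓ j) (pointDensity D ℓ) = pointDensity D (update ℓ j (2 * ℓ j)) := by
  funext x
  obtain ⟨F, hFD, hF⟩ := SeparatedBy.exists_finset hr hD (fun i => x i - 2 * ℓ i)
    (fun i => x i + 2 * ℓ i)
  have key : ∀ s, |s| ≤ ℓ j → pointDensity D ℓ (x + Pi.single j s)
      = ∑ p ∈ F, ∏ i, tent (ℓ i) (p i - (x + Pi.single j s : Fin d → ℝ) i) := by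
    intro s hs
    refine pointDensity_eq_sum hFD fun p hp hpi => (hF p).2 ⟨hp, mem_hbox.2 fun i => ?_⟩
    have h1 := hpi i
    have h2 := hℓ i
    rcases eq_or_ne i j with rfl | hij
    · simp only [Pi.add_apply, Pi.single_eq_same] at h1
      have h3 := abs_lt.1 h1
      have h4 := abs_le.1 hs
      constructor <;> linarith
    · simp only [Pi.add_apply, Pi.single_eq_of_ne hij, add_zero] at h1
      have h3 := abs_lt.1 h1
      constructor <;> linarith
  have h0 := key 0 (by simpa using (hℓ j).le)
  rw [Pi.single_zero, add_zero] at h0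
  unfold lineAverage
  rw [h0, key _ (abs_neg (ℓ j) ▸ (abs_of_pos (hℓ j)).le), key _ (abs_of_pos (hℓ j)).le,
    pointDensity_eq_sum (F := F) hFD, Finset.sum_div, Finset.sum_div, Finset.sum_div,
    ← Finset.sum_add_distrib, ← Finset.sum_add_distrib]
  · refine Finset.sum_congr rfl fun p _ => ?_
    have hsplit : ∀ f : Fin d → ℝ, ∏ i, f i = f j * ∏ i ∈ Finset.univ.erase j, f i := fun f =>
      (Finset.mul_prod_erase _ _ (Finset.mem_univ j)).symm
    have hcongr : ∀ f g : Fin d → ℝ, (∀ i, i ≠ j → f i = g i) →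
        ∏ i ∈ Finset.univ.erase j, f i = ∏ i ∈ Finset.univ.erase j, g i := fun f g hfg =>
      Finset.prod_congr rfl fun i hi => hfg i (Finset.ne_of_mem_erase hi)
    simp only [hsplit, update_self, Pi.add_apply, Pi.single_eq_same]
    rw [hcongr (fun i => tent (ℓ i) (p i - (x i + Pi.single (M := fun _ => ℝ) j (-ℓ j) i)))
        (fun i => tent (ℓ i) (p i - x i)) fun i hi => by simp [hi],
      hcongr (fun i => tent (ℓ i) (p i - (x i + Pi.single (M := fun _ => ℝ) j (ℓ j) i)))
        (fun i => tent (ℓ i) (p i - x i)) fun i hi => by simp [hi],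
      hcongr (fun i => tent (update ℓ j (2 * ℓ j) i) (p i - x i))
        (fun i => tent (ℓ i) (p i - x i)) fun i hi => by simp [hi],
      tent_two_mul (hℓ j), show p j - (x j + -ℓ j) = p j - x j + ℓ j by ring,
      show p j - (x j + ℓ j) = p j - x j - ℓ j by ring]
    ring
  · intro p hp hpi
    refine (hF p).2 ⟨hp, mem_hbox.2 fun i => ?_⟩
    have h1 := hpi i
    have h2 := hℓ i
    have h3 : update ℓ j (2 * ℓ j) i ≤ 2 * ℓ i := by
      rcases eq_or_ne i j with rfl | hij
      · simp
      · simp only [update_of_ne hij]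
        linarith
    have h4 := abs_lt.1 h1
    constructor <;> linarith

/-- The integral of the indicator of a translated cube over a cube is a product of tents. -/
theorem setIntegral_indicator_cube {d : ℕ} {L : ℝ} (hL : 0 < L) (p x : Fin d → ℝ) :
    ∫ y in Set.pi univ fun i => Ioc (x i) (x i + L),
        (Set.pi univ fun i => Ioc (p i) (p i + L)).indicator (fun _ => (1 : ℝ)) y
      = L ^ (2 * d) * ∏ i, tent L (p i - x i) := by
  have hm : MeasurableSet (Set.pi univ fun i => Ioc (p i) (p i + L)) :=
    MeasurableSet.univ_pi fun i => measurableSet_Ioc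
  rw [integral_indicator hm, Measure.restrict_restrict hm, setIntegral_const, smul_eq_mul, mul_one,
    ← Set.pi_inter_distrib, Measure.real]
  simp only [Ioc_inter_Ioc]
  rw [Real.volume_pi_Ioc, ENNReal.toReal_prod, pow_mul, ← Fin.prod_const, ← Finset.prod_mul_distrib]
  refine Finset.prod_congr rfl fun i _ => ?_
  rw [ENNReal.toReal_ofReal']
  unfold tent
  rw [mul_div_cancel₀ _ (pow_pos hL 2).ne', max_comm]
  congr 1
  rw [← max_sub_min_eq_abs, min_add_add_right, max_comm (x i), min_comm (x i)]
  ring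

/-- Half-open cubes used as domains of integration. -/
def iocCube {d : ℕ} (L : ℝ) (x : Fin d → ℝ) : Set (Fin d → ℝ) :=
  Set.pi univ fun i => Ioc (x i) (x i + L)

theorem mem_iocCube {d : ℕ} {L : ℝ} {x y : Fin d → ℝ} :
    y ∈ iocCube L x ↔ ∀ i, x i < y i ∧ y i ≤ x i + L := by
  simp [iocCube]

theorem measurableSet_iocCube {d : ℕ} (L : ℝ) (x : Fin d → ℝ) : MeasurableSet (iocCube L x) :=
  MeasurableSet.univ_pi fun _ => measurableSet_Ioc

theorem volume_iocCube_ne_top {d : ℕ} (L : ℝ) (x : Fin d → ℝ) : volume (iocCube L x) ≠ ⊤ := by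
  rw [iocCube, Real.volume_pi_Ioc]
  exact ENNReal.prod_ne_top fun _ _ => ENNReal.ofReal_ne_top

theorem volume_real_iocCube {d : ℕ} {L : ℝ} (hL : 0 ≤ L) (x : Fin d → ℝ) :
    volume.real (iocCube L x) = L ^ d := by
  rw [Measure.real, iocCube, Real.volume_pi_Ioc_toReal (fun i => by simpa using hL)]
  simp

theorem volume_real_iocCube_diff_le {d : ℕ} {L : ℝ} (hL : 0 < L) (x y : Fin d → ℝ)
    (h : dist x y ≤ L) :
    volume.real (iocCube L x \ iocCube L y) ≤ d * dist x y / L * L ^ d := by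
  have h1 := measureReal_inter_add_sdiff (μ := volume) (s := iocCube L x) (measurableSet_iocCube L y)
    (volume_iocCube_ne_top L x)
  rw [volume_real_iocCube hL.le] at h1
  have h2 : (L - dist x y) ^ d ≤ volume.real (iocCube L x ∩ iocCube L y) := by
    rw [iocCube, iocCube, ← Set.pi_inter_distrib, Measure.real]
    simp only [Ioc_inter_Ioc]
    rw [Real.volume_pi_Ioc, ENNReal.toReal_prod, ← Fin.prod_const]
    refine Finset.prod_le_prod (fun i _ => sub_nonneg.2 h) fun i _ => ?_
    rw [ENNReal.toReal_ofReal', min_add_add_right]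
    have h3 := dist_le_pi_dist x y i
    rw [Real.dist_eq, ← max_sub_min_eq_abs, max_comm, min_comm] at h3
    exact le_max_of_le_left (by linarith)
  have h3 := one_add_mul_le_pow (a := -(dist x y / L)) (by
    have : dist x y / L ≤ 1 := (div_le_one hL).2 h
    linarith) d
  have h4 : (L - dist x y) ^ d = (1 + -(dist x y / L)) ^ d * L ^ d := by
    rw [← mul_pow]
    congr 1
    field_simp
    ring
  have h5 := mul_le_mul_of_nonneg_right h3 (pow_pos hL d).le
  rw [← h4] at h5
  have h6 : (1 + d * -(dist x y / L)) * L ^ d = L ^ d - d * dist x y / L * L ^ d := by ring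
  linarith

/-- The number of points of the finite set `F` counted at `y`. -/
noncomputable def cubeCount {d : ℕ} (F : Finset (Fin d → ℝ)) (L : ℝ) (y : Fin d → ℝ) : ℝ :=
  ∑ p ∈ F, (iocCube L p).indicator (fun _ => (1 : ℝ)) y

theorem integrableOn_cubeCount {d : ℕ} (F : Finset (Fin d → ℝ)) (L : ℝ) (s : Set (Fin d → ℝ)) :
    IntegrableOn (cubeCount F L) s := by
  refine integrable_finsetSum _ fun p _ => ?_
  refine Integrable.integrableOn ?_
  refine (integrable_indicator_iff (measurableSet_iocCube L p)).2 ?_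
  exact integrableOn_const (volume_iocCube_ne_top L p)

theorem cubeCount_eq_boxCount {d : ℕ} {D : Set (Fin d → ℝ)} {F : Finset (Fin d → ℝ)} {L : ℝ}
    {y : Fin d → ℝ} (hF : ↑F ⊆ D) (h : ∀ p ∈ D, y ∈ iocCube L p → p ∈ F) :
    cubeCount F L y = boxCount D (fun i => y i - L) y := by
  classical
  unfold cubeCount boxCount
  have h1 : D ∩ hbox (fun i => y i - L) y = ↑(F.filter fun p => y ∈ iocCube L p) := by
    ext p
    simp only [mem_inter_iff, Finset.coe_filter, mem_ofPred_eq]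
    have hiff : p ∈ hbox (fun i => y i - L) y ↔ y ∈ iocCube L p := by
      rw [mem_hbox, mem_iocCube]
      exact forall_congr' fun i => by
        constructor <;> rintro ⟨a, b⟩ <;> constructor <;> linarith
    rw [hiff]
    exact ⟨fun hp => ⟨h p hp.1 hp.2, hp.2⟩, fun hp => ⟨hF hp.1, hp.2⟩⟩
  rw [h1, Set.ncard_coe_finset, Finset.card_filter]
  push_cast
  refine Finset.sum_congr rfl fun p _ => ?_
  rw [indicator_apply]

theorem setIntegral_cubeCount {d : ℕ} {D : Set (Fin d → ℝ)} {F : Finset (Fin d → ℝ)} {L : ℝ}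
    (hL : 0 < L) {x : Fin d → ℝ} (hF : ↑F ⊆ D) (h : ∀ p ∈ D, (∀ i, |p i - x i| < L) → p ∈ F) :
    ∫ y in iocCube L x, cubeCount F L y = L ^ (2 * d) * pointDensity D (fun _ => L) x := by
  rw [pointDensity_eq_sum hF h, Finset.mul_sum]
  unfold cubeCount
  rw [integral_finsetSum]
  · exact Finset.sum_congr rfl fun p _ => setIntegral_indicator_cube hL p x
  · intro p _
    refine Integrable.integrableOn ?_
    refine (integrable_indicator_iff (measurableSet_iocCube L p)).2 ?_
    exact integrableOn_const (volume_iocCube_ne_top L p)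

theorem abs_pointDensity_sub_le {d : ℕ} (hd : 1 ≤ d) {D : Set (Fin d → ℝ)} {r : ℝ} (hr : 0 < r)
    (hD : SeparatedBy r D) {L α ε : ℝ} (hL : 0 < L)
    (hden : ∀ y, |boxCount D (fun i => y i - L) y - α * L ^ d| ≤ ε * L ^ d) :
    (∀ x, |pointDensity D (fun _ => L) x - α| ≤ ε) ∧
    ∀ x y, |pointDensity D (fun _ => L) x - pointDensity D (fun _ => L) y|
      ≤ 2 * d * ε / L * dist x y := by
  have hLd : 0 < L ^ (2 * d) := pow_pos hL _
  have hε : 0 ≤ ε := by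
    have h1 := (abs_nonneg _).trans (hden 0)
    exact nonneg_of_mul_nonneg_left h1 (pow_pos hL d)
  have hgood : ∀ (F : Finset (Fin d → ℝ)) (x : Fin d → ℝ), ↑F ⊆ D →
      (∀ p ∈ D, (∀ i, |p i - x i| ≤ L) → p ∈ F) →
      L ^ (2 * d) * (pointDensity D (fun _ => L) x - α)
        = ∫ y in iocCube L x, (cubeCount F L y - α * L ^ d) ∧
      ∀ y ∈ iocCube L x, ‖cubeCount F L y - α * L ^ d‖ ≤ ε * L ^ d := by
    intro F x hFD hF
    constructor
    · rw [integral_sub (integrableOn_cubeCount F L _)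
        (integrableOn_const (volume_iocCube_ne_top L x)),
        setIntegral_cubeCount hL hFD fun p hp hpi => hF p hp fun i => (hpi i).le,
        setIntegral_const, volume_real_iocCube hL.le, smul_eq_mul]
      ring
    · intro y hy
      rw [cubeCount_eq_boxCount hFD]
      · exact hden y
      · intro p hp hpy
        refine hF p hp fun i => ?_
        have h1 := mem_iocCube.1 hy i
        have h2 := mem_iocCube.1 hpy i
        exact abs_le.2 ⟨by linarith, by linarith⟩
  have hbound : ∀ x, |pointDensity D (fun _ => L) x - α| ≤ ε := by
    intro x
    obtain ⟨F, hFD, hF⟩ := SeparatedBy.exists_finset hr hD (fun i => x i - 2 * L)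
      (fun i => x i + 2 * L)
    obtain ⟨h1, h2⟩ := hgood F x hFD fun p hp hpi => (hF p).2 ⟨hp, mem_hbox.2 fun i => by
      have := abs_le.1 (hpi i)
      constructor <;> linarith⟩
    have h3 := norm_setIntegral_le_of_norm_le_const (μ := volume)
      (volume_iocCube_ne_top L x).lt_top h2
    rw [← h1, volume_real_iocCube hL.le, Real.norm_eq_abs, abs_mul, abs_of_pos hLd] at h3
    refine le_of_mul_le_mul_left (h3.trans_eq ?_) hLd
    ring
  refine ⟨hbound, fun x y => ?_⟩
  rcases le_or_gt (dist x y) L with hxy | hxy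
  · obtain ⟨F, hFD, hF⟩ := SeparatedBy.exists_finset hr hD (fun i => x i - 3 * L)
      (fun i => x i + 3 * L)
    obtain ⟨h1, h2⟩ := hgood F x hFD fun p hp hpi => (hF p).2 ⟨hp, mem_hbox.2 fun i => by
      have := abs_le.1 (hpi i)
      constructor <;> linarith⟩
    obtain ⟨h3, h4⟩ := hgood F y hFD fun p hp hpi => (hF p).2 ⟨hp, mem_hbox.2 fun i => by
      have h1 := abs_le.1 (hpi i)
      have h2 := dist_le_pi_dist x y i
      rw [Real.dist_eq] at h2
      have h3 := abs_le.1 h2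
      constructor <;> linarith⟩
    have hintg : ∀ z, IntegrableOn (fun y => cubeCount F L y - α * L ^ d) (iocCube L z) := fun z =>
      (integrableOn_cubeCount F L _).sub (integrableOn_const (volume_iocCube_ne_top L z))
    have h5 := integral_inter_add_sdiff (measurableSet_iocCube L y) (hintg x)
    have h6 := integral_inter_add_sdiff (measurableSet_iocCube L x) (hintg y)
    rw [inter_comm] at h6
    have hdiff : ∀ z w, (∀ y ∈ iocCube L z, ‖cubeCount F L y - α * L ^ d‖ ≤ ε * L ^ d) →
        dist z w ≤ L → |∫ y in iocCube L z \ iocCube L w, (cubeCount F L y - α * L ^ d)|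
          ≤ ε * L ^ d * (d * dist z w / L * L ^ d) := by
      intro z w hz hzw
      have h7 := norm_setIntegral_le_of_norm_le_const (μ := volume)
        (s := iocCube L z \ iocCube L w) (f := fun y => cubeCount F L y - α * L ^ d)
        (C := ε * L ^ d)
        ((measure_mono sdiff_subset).trans_lt (volume_iocCube_ne_top L z).lt_top)
        fun y hy => hz y hy.1
      exact h7.trans (mul_le_mul_of_nonneg_left (volume_real_iocCube_diff_le hL z w hzw)
        (mul_nonneg hε (pow_pos hL d).le))
    have h7 := abs_le.1 (hdiff x y h2 hxy)
    have h8 := abs_le.1 (hdiff y x h4 (dist_comm x y ▸ hxy))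
    rw [dist_comm y x] at h8
    have h9 : L ^ (2 * d) * |pointDensity D (fun _ => L) x - pointDensity D (fun _ => L) y|
        ≤ L ^ (2 * d) * (2 * d * ε / L * dist x y) := by
      have h10 : L ^ (2 * d) * (pointDensity D (fun _ => L) x - pointDensity D (fun _ => L) y)
          = (∫ y in iocCube L x \ iocCube L y, (cubeCount F L y - α * L ^ d))
            - ∫ z in iocCube L y \ iocCube L x, (cubeCount F L z - α * L ^ d) := by
        linarith
      have h11 : L ^ (2 * d) * (2 * d * ε / L * dist x y)
          = 2 * (ε * L ^ d * (d * dist x y / L * L ^ d)) := by ring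
      rw [← abs_of_pos hLd, ← abs_mul, abs_of_pos hLd, h10, h11]
      exact abs_le.2 ⟨by linarith, by linarith⟩
    exact le_of_mul_le_mul_left h9 hLd
  · have h1 := abs_le.1 (hbound x)
    have h2 := abs_le.1 (hbound y)
    have h3 : 1 ≤ dist x y / L := ((one_lt_div hL).2 hxy).le
    have h4 : (1 : ℝ) ≤ d := by exact_mod_cast hd
    have h5 : 2 * d * ε / L * dist x y = 2 * ε * (d * (dist x y / L)) := by ring
    have h6 : 1 ≤ d * (dist x y / L) := one_le_mul_of_one_le_of_one_le h4 h3
    have h7 : 2 * ε ≤ 2 * d * ε / L * dist x y := by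
      rw [h5]
      exact le_mul_of_one_le_right (by linarith) h6
    exact abs_le.2 ⟨by linarith, by linarith⟩

theorem integral_tent {L : ℝ} (hL : 0 < L) (p : ℝ) :
    Integrable (fun x => tent L (p - x)) ∧ ∫ x, tent L (p - x) = 1 := by
  have hcont : Continuous (tent L) := by
    unfold tent
    fun_prop
  have hsupp : support (tent L) ⊆ Ioc (-L) L := by
    intro u hu
    by_contra h
    refine hu (tent_eq_zero ?_)
    by_contra h'
    have := abs_lt.1 (not_le.1 h')
    exact h ⟨this.1, this.2.le⟩
  have hintg : ∫ x, tent L x = 1 := by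
    rw [← setIntegral_eq_integral_of_forall_compl_eq_zero (s := Ioc (-L) L)
      fun x hx => notMem_support.1 fun h => hx (hsupp h),
      ← intervalIntegral.integral_of_le (by linarith),
      ← intervalIntegral.integral_add_adjacent_intervals (b := 0) (hcont.intervalIntegrable _ _)
        (hcont.intervalIntegrable _ _)]
    have h1 : ∫ x in (-L)..0, tent L x = ∫ x in (-L)..0, (L + x) / L ^ 2 := by
      refine intervalIntegral.integral_congr fun x hx => ?_
      rw [uIcc_of_le (by linarith)] at hx
      simp only [tent]
      rw [abs_of_nonpos hx.2, max_eq_right (by linarith [hx.1])]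
      ring
    have h2 : ∫ x in (0 : ℝ)..L, tent L x = ∫ x in (0 : ℝ)..L, (L - x) / L ^ 2 := by
      refine intervalIntegral.integral_congr fun x hx => ?_
      rw [uIcc_of_le (by linarith)] at hx
      simp only [tent]
      rw [abs_of_nonneg hx.1, max_eq_right (by linarith [hx.2])]
    rw [h1, h2, intervalIntegral.integral_div, intervalIntegral.integral_div,
      intervalIntegral.integral_add (by simp) (by simp),
      intervalIntegral.integral_sub (by simp) (by simp)]
    simp
    field_simp
    ring
  have hI : Integrable (tent L) := by
    by_contra h
    rw [integral_undef h] at hintg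
    norm_num at hintg
  exact ⟨hI.comp_sub_left p, by rw [integral_sub_left_eq_self (tent L) volume p, hintg]⟩

theorem lintegral_prod_tent {d : ℕ} {L : ℝ} (hL : 0 < L) (p : Fin d → ℝ) :
    ∫⁻ x : Fin d → ℝ, ENNReal.ofReal (∏ i, tent L (p i - x i)) = 1 := by
  rw [← ofReal_integral_eq_lintegral_ofReal]
  · rw [integral_fintype_prod_volume_eq_prod fun i x => tent L (p i - x)]
    simp [(integral_tent hL _).2]
  · exact Integrable.fintype_prod fun i => (integral_tent hL (p i)).1
  · exact Filter.Eventually.of_forall fun x => Finset.prod_nonneg fun i _ => tent_nonneg _ _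

theorem measurable_prod_tent {d : ℕ} (L : ℝ) (p : Fin d → ℝ) :
    Measurable fun x : Fin d → ℝ => ENNReal.ofReal (∏ i, tent L (p i - x i)) := by
  refine ENNReal.measurable_ofReal.comp (Continuous.measurable ?_)
  unfold tent
  fun_prop

theorem ofReal_sum_prod_tent {d : ℕ} (L : ℝ) (F : Finset (Fin d → ℝ)) (x : Fin d → ℝ) :
    ENNReal.ofReal (∑ p ∈ F, ∏ i, tent L (p i - x i))
      = ∑ p ∈ F, ENNReal.ofReal (∏ i, tent L (p i - x i)) :=
  ENNReal.ofReal_sum_of_nonneg fun _ _ => Finset.prod_nonneg fun _ _ => tent_nonneg _ _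

/-- The mass of the smoothed density near a finite subset of `D`. -/
theorem card_le_setLIntegral_pointDensity {d : ℕ} {D : Set (Fin d → ℝ)} {r : ℝ} (hr : 0 < r)
    (hD : SeparatedBy r D) {L : ℝ} (hL : 0 < L) {S : Finset (Fin d → ℝ)} (hS : ↑S ⊆ D)
    {B : Set (Fin d → ℝ)} (hB : ∀ p ∈ S, ∀ x, dist p x ≤ L → x ∈ B) :
    (S.card : ℝ≥0∞) ≤ ∫⁻ x in B, ENNReal.ofReal (pointDensity D (fun _ => L) x) := by
  classical
  have h1 : ∀ p ∈ S, ∫⁻ x in B, ENNReal.ofReal (∏ i, tent L (p i - x i)) = 1 := by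
    intro p hp
    rw [← lintegral_prod_tent hL p]
    refine setLIntegral_eq_of_support_subset fun x hx => hB p hp x ?_
    by_contra h
    refine hx ?_
    obtain ⟨i, hi⟩ : ∃ i, L < dist (p i) (x i) := by
      by_contra hcon
      push Not at hcon
      exact h ((dist_pi_le_iff hL.le).2 hcon)
    have : tent L (p i - x i) = 0 := tent_eq_zero (Real.dist_eq (p i) (x i) ▸ hi.le)
    change ENNReal.ofReal (∏ i, tent L (p i - x i)) = 0
    rw [Finset.prod_eq_zero (Finset.mem_univ i) this, ENNReal.ofReal_zero]
  calc (S.card : ℝ≥0∞) = ∑ p ∈ S, ∫⁻ x in B, ENNReal.ofReal (∏ i, tent L (p i - x i)) := by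
        rw [Finset.sum_congr rfl h1]
        simp
    _ = ∫⁻ x in B, ∑ p ∈ S, ENNReal.ofReal (∏ i, tent L (p i - x i)) :=
        (lintegral_finsetSum _ fun p _ => measurable_prod_tent L p).symm
    _ ≤ _ := lintegral_mono fun x => by
        simp only
        rw [← ofReal_sum_prod_tent]
        refine ENNReal.ofReal_le_ofReal ?_
        obtain ⟨F, hFD, hF⟩ := SeparatedBy.exists_finset hr hD (fun i => x i - 2 * L)
          (fun i => x i + 2 * L)
        rw [pointDensity_eq_sum (F := S ∪ F)]
        · exact Finset.sum_le_sum_of_subset_of_nonneg Finset.subset_union_left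
            fun p _ _ => Finset.prod_nonneg fun i _ => tent_nonneg _ _
        · rw [Finset.coe_union]
          exact union_subset hS hFD
        · intro p hp hpi
          refine Finset.mem_union_right _ ((hF p).2 ⟨hp, mem_hbox.2 fun i => ?_⟩)
          have := abs_lt.1 (hpi i)
          constructor <;> linarith

theorem setLIntegral_pointDensity_le_card {d : ℕ} {D : Set (Fin d → ℝ)} {L : ℝ} (hL : 0 < L)
    {T : Finset (Fin d → ℝ)} (hT : ↑T ⊆ D) {B : Set (Fin d → ℝ)} (hBm : MeasurableSet B)
    (hB : ∀ p ∈ D, ∀ x ∈ B, dist p x ≤ L → p ∈ T) :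
    ∫⁻ x in B, ENNReal.ofReal (pointDensity D (fun _ => L) x) ≤ T.card := by
  calc ∫⁻ x in B, ENNReal.ofReal (pointDensity D (fun _ => L) x)
      = ∫⁻ x in B, ∑ p ∈ T, ENNReal.ofReal (∏ i, tent L (p i - x i)) := by
        refine setLIntegral_congr_fun hBm fun x hx => ?_
        rw [← ofReal_sum_prod_tent, pointDensity_eq_sum hT]
        intro p hp hpi
        refine hB p hp x hx ((dist_pi_le_iff hL.le).2 fun i => ?_)
        rw [Real.dist_eq]
        exact (hpi i).le
    _ ≤ ∫⁻ x : Fin d → ℝ, ∑ p ∈ T, ENNReal.ofReal (∏ i, tent L (p i - x i)) :=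
        setLIntegral_le_lintegral _ _
    _ = ∑ p ∈ T, ∫⁻ x : Fin d → ℝ, ENNReal.ofReal (∏ i, tent L (p i - x i)) :=
        lintegral_finsetSum _ fun p _ => measurable_prod_tent L p
    _ = T.card := by simp [lintegral_prod_tent hL]

/-- Doubling the smoothing scale is realised by a bi-Lipschitz transport. -/
theorem exists_transport_double {d : ℕ} (hd : 1 ≤ d) {D : Set (Fin d → ℝ)} {r : ℝ} (hr : 0 < r)
    (hD : SeparatedBy r D) {L α ε : ℝ} (hα : 0 < α) (hL : 0 < L) (hε : 8 * d * ε ≤ α)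
    (hden : ∀ y, |boxCount D (fun i => y i - L) y - α * L ^ d| ≤ ε * L ^ d) :
    ∃ e : (Fin d → ℝ) ≃ (Fin d → ℝ), IsBiLip ((1 + 2 * (4 * d * ε / α).toNNReal) ^ d) e ∧
      Measure.map e
        (volume.withDensity fun x => ENNReal.ofReal (pointDensity D (fun _ => L) x))
        = volume.withDensity fun x => ENNReal.ofReal (pointDensity D (fun _ => 2 * L) x) := by
  classical
  have hε0 : 0 ≤ ε :=
    nonneg_of_mul_nonneg_left ((abs_nonneg _).trans (hden 0)) (pow_pos hL d)
  have hd1 : (1 : ℝ) ≤ d := by exact_mod_cast hd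
  have hε2 : ε ≤ α / 2 := by nlinarith
  obtain ⟨hb, hl⟩ := abs_pointDensity_sub_le hd hr hD hL hden
  set K := 1 + 2 * (4 * d * ε / α).toNNReal with hK
  suffices H : ∀ S : Finset (Fin d), ∃ e : (Fin d → ℝ) ≃ (Fin d → ℝ), IsBiLip (K ^ S.card) e ∧
      Measure.map e
        (volume.withDensity fun x => ENNReal.ofReal (pointDensity D (fun _ => L) x))
        = (volume.withDensity fun x => ENNReal.ofReal
          (pointDensity D (fun i => if i ∈ S then 2 * L else L) x)) ∧
      (∀ x, |pointDensity D (fun i => if i ∈ S then 2 * L else L) x - α| ≤ ε) ∧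
      ∀ x y, |pointDensity D (fun i => if i ∈ S then 2 * L else L) x
        - pointDensity D (fun i => if i ∈ S then 2 * L else L) y| ≤ 2 * d * ε / L * dist x y by
    obtain ⟨e, he, hm, -⟩ := H Finset.univ
    refine ⟨e, by simpa using he, ?_⟩
    simpa using hm
  intro S
  induction S using Finset.induction_on with
  | empty =>
    refine ⟨Equiv.refl _, by simpa using IsBiLip.refl, ?_, by simpa using hb, by simpa using hl⟩
    simp only [Equiv.coe_refl, Measure.map_id, Finset.notMem_empty, if_false]
  | insert j S hj ih =>
    obtain ⟨e, he, hm, hb', hl'⟩ := ih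
    set ℓ : Fin d → ℝ := fun i => if i ∈ S then 2 * L else L with hℓ
    have hℓj : ℓ j = L := if_neg hj
    have hℓ' : update ℓ j (2 * ℓ j) = fun i => if i ∈ insert j S then 2 * L else L := by
      funext i
      rcases eq_or_ne i j with rfl | hij
      · simp [hℓj]
      · simp [hij, hℓ]
    have hℓpos : ∀ i, 0 < ℓ i := fun i => by
      simp only [hℓ]
      split_ifs <;> linarith
    have hav := lineAverage_pointDensity hr hD j ℓ hℓpos
    rw [hℓ', hℓj] at hav
    have hη : 2 * L * (2 * d * ε / L) / α = 4 * d * ε / α := by field_simp; ring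
    obtain ⟨e', he', hm'⟩ := exists_map_withDensity_eq_lineAverage j hα hε2
      (by positivity : 0 ≤ 2 * d * ε / L) hL hb' hl' (by
        rw [hη, div_le_iff₀ hα]
        linarith)
    rw [hη] at he'
    refine ⟨e.trans e', ?_, ?_, ?_, ?_⟩
    · rw [Finset.card_insert_of_notMem hj, pow_succ]
      exact he.trans he'
    · rw [Equiv.coe_trans, ← Measure.map_map he'.1.continuous.measurable
        he.1.continuous.measurable, hm, hm', hav]
    · rw [← hav]
      exact abs_lineAverage_sub_le hb'
    · rw [← hav]
      exact abs_lineAverage_sub_lineAverage_le hl'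

/-- Uniformly bi-Lipschitz transports of a smoothed point density to densities converging to a
constant. -/
theorem exists_transport_sequence {d : ℕ} (hd : 1 ≤ d) {r R C : ℝ} {D : Set (Fin d → ℝ)}
    (hr : 0 < r) (hD : SeparatedBy r D) (hR : ∀ x, ∃ y ∈ D, dist x y ≤ R)
    (hC : CubeRepetitive C D) :
    ∃ (α L : ℝ) (K : ℝ≥0) (δ : ℕ → ℝ) (g : ℕ → (Fin d → ℝ) → ℝ)
      (e : ℕ → (Fin d → ℝ) ≃ (Fin d → ℝ)), 0 < α ∧ 0 < L ∧
      Filter.Tendsto δ Filter.atTop (nhds 0) ∧ (∀ n, IsBiLip K (e n)) ∧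
      (∀ n x, |g n x - α| ≤ δ n) ∧
      ∀ n, Measure.map (e n)
        (volume.withDensity fun x => ENNReal.ofReal (pointDensity D (fun _ => L) x))
        = volume.withDensity fun x => ENNReal.ofReal (g n x) := by
  obtain ⟨n₀, α, A, s, hα, hA, hs0, hs1, hden⟩ := exists_density hr hD hR hC
  have hden' : ∀ n, n₀ ≤ n → ∀ y : Fin d → ℝ,
      |boxCount D (fun i => y i - 2 ^ n) y - α * (2 ^ n) ^ d| ≤ A * s ^ n * (2 ^ n) ^ d := by
    intro n hn y
    have h1 := hden n hn (fun i => y i - 2 ^ n) y fun i => by simp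
    have h2 : boxVol (fun i => y i - 2 ^ n) y = (2 ^ n) ^ d := by simp [boxVol]
    rwa [h2] at h1
  have htend : Filter.Tendsto (fun n : ℕ => 8 * d * (A * s ^ n)) Filter.atTop (nhds 0) := by
    have := ((tendsto_pow_atTop_nhds_zero_of_lt_one hs0.le hs1).const_mul A).const_mul (8 * d : ℝ)
    simpa using this
  obtain ⟨n₁, hn₁⟩ : ∃ n₁, ∀ n, n₁ ≤ n → 8 * d * (A * s ^ n) ≤ α :=
    Filter.eventually_atTop.1 (htend.eventually_le_const hα)
  set m := max n₀ n₁ with hm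
  set c : ℕ → ℝ := fun k => 4 * d * (A * s ^ (m + k)) / α with hc
  have hc0 : ∀ k, 0 ≤ c k := fun k => by positivity
  have hstep : ∀ k, ∃ e : (Fin d → ℝ) ≃ (Fin d → ℝ), IsBiLip ((1 + 2 * (c k).toNNReal) ^ d) e ∧
      Measure.map e
        (volume.withDensity fun x => ENNReal.ofReal (pointDensity D (fun _ => 2 ^ (m + k)) x))
        = volume.withDensity fun x =>
          ENNReal.ofReal (pointDensity D (fun _ => 2 ^ (m + (k + 1))) x) := by
    intro k
    have := exists_transport_double hd hr hD hα (L := 2 ^ (m + k)) (by positivity)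
      (hn₁ (m + k) ((le_max_right _ _).trans (Nat.le_add_right _ _)))
      (hden' (m + k) ((le_max_left _ _).trans (Nat.le_add_right _ _)))
    rwa [← pow_succ'] at this
  have hseq : ∀ n : ℕ, ∃ e : (Fin d → ℝ) ≃ (Fin d → ℝ),
      IsBiLip (Real.exp (2 * d * ∑ k ∈ Finset.range n, c k)).toNNReal e ∧
      Measure.map e
        (volume.withDensity fun x => ENNReal.ofReal (pointDensity D (fun _ => 2 ^ m) x))
        = volume.withDensity fun x =>
          ENNReal.ofReal (pointDensity D (fun _ => 2 ^ (m + n)) x) := by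
    intro n
    induction n with
    | zero =>
      refine ⟨Equiv.refl _, by simpa using IsBiLip.refl, ?_⟩
      simp
    | succ n ih =>
      obtain ⟨e, he, hme⟩ := ih
      obtain ⟨f, hf, hmf⟩ := hstep n
      refine ⟨e.trans f, (he.trans hf).mono ?_, ?_⟩
      · rw [← NNReal.coe_le_coe]
        push_cast
        rw [Real.coe_toNNReal _ (Real.exp_pos _).le, Real.coe_toNNReal _ (Real.exp_pos _).le,
          Real.coe_toNNReal _ (hc0 n), Finset.sum_range_succ, mul_add, Real.exp_add]
        refine mul_le_mul_of_nonneg_left ?_ (Real.exp_pos _).le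
        calc (1 + 2 * c n) ^ d ≤ Real.exp (2 * c n) ^ d := by
              refine pow_le_pow_left₀ (by linarith [hc0 n]) ?_ _
              linarith [Real.add_one_le_exp (2 * c n)]
          _ = Real.exp (2 * d * c n) := by
              rw [← Real.exp_nat_mul]
              congr 1
              ring
      · rw [Equiv.coe_trans, ← Measure.map_map hf.1.continuous.measurable
          he.1.continuous.measurable, hme, hmf]
  choose e he hme using hseq
  have hsumm : Summable c := by
    have h1 : c = fun k => 4 * d * (A * s ^ m) / α * s ^ k := by
      funext k
      simp only [hc, pow_add]
      ring
    rw [h1]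
    exact (summable_geometric_of_lt_one hs0.le hs1).mul_left _
  refine ⟨α, 2 ^ m, (Real.exp (2 * d * ∑' k, c k)).toNNReal, fun n => A * s ^ (m + n),
    fun n => pointDensity D (fun _ => 2 ^ (m + n)), e, hα, by positivity, ?_, ?_, ?_, hme⟩
  · have h1 : Filter.Tendsto (fun n => A * s ^ m * s ^ n) Filter.atTop (nhds (A * s ^ m * 0)) :=
      (tendsto_pow_atTop_nhds_zero_of_lt_one hs0.le hs1).const_mul _
    rw [mul_zero] at h1
    refine h1.congr fun n => ?_
    rw [pow_add]
    ring
  · intro n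
    refine (he n).mono (Real.toNNReal_le_toNNReal (Real.exp_le_exp.2 ?_))
    exact mul_le_mul_of_nonneg_left (hsumm.sum_le_tsum _ fun k _ => hc0 k) (by positivity)
  · intro n x
    exact (abs_pointDensity_sub_le hd hr hD (by positivity)
      (hden' (m + n) ((le_max_left _ _).trans (Nat.le_add_right _ _)))).1 x

/-- Pointwise ultralimits of uniformly bi-Lipschitz homeomorphisms fixing a point. -/
theorem exists_biLip_limit {E : Type*} [MetricSpace E] [ProperSpace E] {K : ℝ≥0} (o : E)
    {e : ℕ → E ≃ E} (he : ∀ n, IsBiLip K (e n)) (h0 : ∀ n, e n o = o) :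
    ∃ f : E ≃ E, IsBiLip K f ∧
      ∀ x, Filter.Tendsto (fun n => e n x) (Filter.hyperfilter ℕ) (nhds (f x)) := by
  have hlim : ∀ f : ℕ → E → E, (∀ n, LipschitzWith K (f n)) → (∀ n, f n o = o) →
      ∃ F : E → E, LipschitzWith K F ∧
        ∀ x, Filter.Tendsto (fun n => f n x) (Filter.hyperfilter ℕ) (nhds (F x)) := by
    intro f hf hf0
    have hx : ∀ x, ∃ y, Filter.Tendsto (fun n => f n x) (Filter.hyperfilter ℕ) (nhds y) := by
      intro x
      have hmem : ∀ n, f n x ∈ Metric.closedBall o (K * dist x o) := fun n => by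
        have := (hf n).dist_le_mul x o
        rwa [hf0] at this
      obtain ⟨y, -, hy⟩ := (isCompact_closedBall o (K * dist x o)).ultrafilter_le_nhds
        ((Filter.hyperfilter ℕ).map fun n => f n x) (by
          rw [Filter.le_principal_iff, Ultrafilter.coe_map, Filter.mem_map]
          exact Filter.Eventually.of_forall hmem)
      exact ⟨y, hy⟩
    choose F hF using hx
    refine ⟨F, LipschitzWith.of_dist_le_mul fun x y => ?_, hF⟩
    exact le_of_tendsto ((hF x).dist (hF y))
      (Filter.Eventually.of_forall fun n => (hf n).dist_le_mul x y)
  obtain ⟨F, hFl, hF⟩ := hlim (fun n => e n) (fun n => (he n).1) h0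
  obtain ⟨G, hGl, hG⟩ := hlim (fun n => (e n).symm) (fun n => (he n).2) fun n => by
    rw [Equiv.symm_apply_eq, h0]
  have hinv : ∀ (f g : ℕ → E → E) (F G : E → E), (∀ n, LipschitzWith K (f n)) →
      (∀ n x, f n (g n x) = x) →
      (∀ x, Filter.Tendsto (fun n => f n x) (Filter.hyperfilter ℕ) (nhds (F x))) →
      (∀ x, Filter.Tendsto (fun n => g n x) (Filter.hyperfilter ℕ) (nhds (G x))) →
      ∀ x, F (G x) = x := by
    intro f g F G hf hfg hF hG x
    refine tendsto_nhds_unique (hF (G x)) ?_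
    rw [tendsto_iff_dist_tendsto_zero]
    have h1 : Filter.Tendsto (fun n => (K : ℝ) * dist (G x) (g n x)) (Filter.hyperfilter ℕ)
        (nhds 0) := by
      have := ((tendsto_const_nhds (x := G x)).dist (hG x)).const_mul (K : ℝ)
      simpa using this
    refine squeeze_zero (fun _ => dist_nonneg) (fun n => ?_) h1
    have := (hf n).dist_le_mul (G x) (g n x)
    rwa [hfg] at this
  refine ⟨⟨F, G, ?_, ?_⟩, ⟨hFl, hGl⟩, hF⟩
  · exact hinv _ _ G F (fun n => (he n).2) (fun n x => (e n).symm_apply_apply x) hG hF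
  · exact hinv _ _ F G (fun n => (he n).1) (fun n x => (e n).apply_symm_apply x) hF hG

theorem finite_setOf_dist_lattice_le {d : ℕ} {s : ℝ} (hs : 0 < s) (x : Fin d → ℝ) (M : ℝ) :
    {z : Fin d → ℤ | dist x (fun i => s * z i) ≤ M}.Finite := by
  refine (Set.finite_Icc (fun i => ⌊(x i - M) / s⌋) (fun i => ⌈(x i + M) / s⌉)).subset ?_
  intro z hz
  have hz' : ∀ i, |x i - s * z i| ≤ M := fun i => by
    have := (dist_le_pi_dist x (fun i => s * (z i : ℝ)) i).trans hz
    rwa [Real.dist_eq] at this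
  refine ⟨fun i => ?_, fun i => ?_⟩
  · have h1 := (abs_le.1 (hz' i)).2
    have h2 : ((⌊(x i - M) / s⌋ : ℤ) : ℝ) ≤ z i :=
      (Int.floor_le _).trans ((div_le_iff₀ hs).2 (by linarith))
    exact_mod_cast h2
  · have h1 := (abs_le.1 (hz' i)).1
    have h2 : (z i : ℝ) ≤ (⌈(x i + M) / s⌉ : ℤ) :=
      ((le_div_iff₀ hs).2 (by linarith)).trans (Int.le_ceil _)
    exact_mod_cast h2

/-- Half-open lattice cubes with a common offset. -/
def latticeCube {d : ℕ} (s : ℝ) (o : Fin d → ℝ) (z : Fin d → ℤ) : Set (Fin d → ℝ) :=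
  iocCube s fun i => o i + s * z i

theorem exists_mem_latticeCube {d : ℕ} {s : ℝ} (hs : 0 < s) (o y : Fin d → ℝ) :
    ∃ z, y ∈ latticeCube s o z := by
  refine ⟨fun i => ⌈(y i - o i) / s⌉ - 1, mem_iocCube.2 fun i => ?_⟩
  have h1 := Int.le_ceil ((y i - o i) / s)
  have h2 := Int.ceil_lt_add_one ((y i - o i) / s)
  rw [div_le_iff₀ hs] at h1
  rw [← sub_lt_iff_lt_add, lt_div_iff₀ hs] at h2
  push_cast
  constructor <;> nlinarith

theorem disjoint_latticeCube {d : ℕ} {s : ℝ} (hs : 0 < s) (o : Fin d → ℝ) {z w : Fin d → ℤ}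
    (h : z ≠ w) : Disjoint (latticeCube s o z) (latticeCube s o w) := by
  rw [Set.disjoint_left]
  intro y hz hw
  refine h (funext fun i => ?_)
  obtain ⟨h1, h2⟩ := mem_iocCube.1 hz i
  obtain ⟨h3, h4⟩ := mem_iocCube.1 hw i
  have h5 : (z i : ℝ) < w i + 1 := lt_of_mul_lt_mul_left (by linarith) hs.le
  have h6 : (w i : ℝ) < z i + 1 := lt_of_mul_lt_mul_left (by linarith) hs.le
  have h7 : z i < w i + 1 := by exact_mod_cast h5
  have h8 : w i < z i + 1 := by exact_mod_cast h6
  omega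

theorem dist_le_of_mem_latticeCube {d : ℕ} {s : ℝ} (hs : 0 < s) {o y : Fin d → ℝ}
    {z : Fin d → ℤ} (h : y ∈ latticeCube s o z) : dist (y - o) (fun i => s * z i) ≤ s := by
  refine (dist_pi_le_iff hs.le).2 fun i => ?_
  obtain ⟨h1, h2⟩ := mem_iocCube.1 h i
  rw [Real.dist_eq, Pi.sub_apply]
  exact abs_le.2 ⟨by linarith, by linarith⟩

theorem volume_latticeCube {d : ℕ} {s : ℝ} (o : Fin d → ℝ) (z : Fin d → ℤ) :
    volume (latticeCube s o z) = ENNReal.ofReal s ^ d := by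
  rw [latticeCube, iocCube, Real.volume_pi_Ioc]
  simp

/-- A set whose smoothed density can be transported to almost constant densities is at bounded
distance from a lattice after a bi-Lipschitz change of variables. -/
theorem exists_equiv_lattice {d : ℕ} {D : Set (Fin d → ℝ)} {r : ℝ} (hr : 0 < r)
    (hD : SeparatedBy r D) {μ : Measure (Fin d → ℝ)} {α L s : ℝ} {K : ℝ≥0} {δ : ℕ → ℝ}
    {g : ℕ → (Fin d → ℝ) → ℝ} {e : ℕ → (Fin d → ℝ) ≃ (Fin d → ℝ)} (hs : 0 < s)
    (hsα : α * s ^ d = 1)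
    (hμ₁ : ∀ (S : Finset (Fin d → ℝ)) (B : Set (Fin d → ℝ)), ↑S ⊆ D → MeasurableSet B →
      (∀ p ∈ S, ∀ x, dist p x ≤ L → x ∈ B) → (S.card : ℝ≥0∞) ≤ μ B)
    (hμ₂ : ∀ (S : Finset (Fin d → ℝ)) (B : Set (Fin d → ℝ)), ↑S ⊆ D → MeasurableSet B →
      (∀ p ∈ D, ∀ x ∈ B, dist p x ≤ L → p ∈ S) → μ B ≤ S.card)
    (hδ : Filter.Tendsto δ Filter.atTop (nhds 0)) (he : ∀ n, IsBiLip K (e n))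
    (hg : ∀ n x, |g n x - α| ≤ δ n)
    (hmap : ∀ n, Measure.map (e n) μ = volume.withDensity fun x => ENNReal.ofReal (g n x)) :
    ∃ (f : (Fin d → ℝ) ≃ (Fin d → ℝ)) (φ : D ≃ (Fin d → ℤ)) (M : ℝ), IsBiLip K f ∧
      ∀ p : D, dist (f p) (fun i => s * φ p i) ≤ M := by
  classical
  set e' : ℕ → (Fin d → ℝ) ≃ (Fin d → ℝ) := fun n => (e n).trans (Equiv.subRight (e n 0)) with he'
  have he'a : ∀ n x, e' n x = e n x - e n 0 := fun n x => rfl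
  have hbi : ∀ n, IsBiLip K (e' n) := by
    intro n
    constructor
    · refine LipschitzWith.of_dist_le_mul fun x y => ?_
      rw [he'a, he'a, dist_sub_right]
      exact (he n).1.dist_le_mul x y
    · refine LipschitzWith.of_dist_le_mul fun x y => ?_
      have := (he n).2.dist_le_mul (x + e n 0) (y + e n 0)
      rwa [dist_add_right] at this
  obtain ⟨f, hf, hlim⟩ := exists_biLip_limit 0 hbi fun n => by rw [he'a, sub_self]
  have hclose : ∀ x, ∀ᶠ n in (Filter.hyperfilter ℕ : Filter ℕ), dist (e' n x) (f x) ≤ 1 := fun x =>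
    ((tendsto_iff_dist_tendsto_zero.1 (hlim x)).eventually (ge_mem_nhds one_pos))
  have hδ' : Filter.Tendsto δ (Filter.hyperfilter ℕ) (nhds 0) :=
    hδ.mono_left Nat.hyperfilter_le_atTop
  set M : ℝ := 1 + K * L + s with hM
  have hnear : ∀ n p x z, dist (e' n p) (f p) ≤ 1 → dist p x ≤ L →
      e n x ∈ latticeCube s (e n 0) z → dist (f p) (fun i => s * z i) ≤ M := by
    intro n p x z h1 h2 h3
    have h4 := dist_le_of_mem_latticeCube hs h3
    have h5 := ((hbi n).1.dist_le_mul p x).trans (mul_le_mul_of_nonneg_left h2 K.2)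
    have h6 := dist_triangle4 (f p) (e' n p) (e' n x) (fun i => s * (z i : ℝ))
    rw [dist_comm (f p) (e' n p)] at h6
    rw [← he'a] at h4
    linarith
  have hcube : ∀ n (T : Finset (Fin d → ℤ)),
      ENNReal.ofReal (T.card * (1 - δ n * s ^ d)) ≤ μ (e n ⁻¹' ⋃ z ∈ T, latticeCube s (e n 0) z) ∧
      μ (e n ⁻¹' ⋃ z ∈ T, latticeCube s (e n 0) z) ≤
        ENNReal.ofReal (T.card * (1 + δ n * s ^ d)) := by
    intro n T
    have hm : ∀ z, MeasurableSet (latticeCube s (e n 0) z) := fun z => measurableSet_iocCube _ _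
    have hm' : MeasurableSet (⋃ z ∈ T, latticeCube s (e n 0) z) :=
      T.measurableSet_biUnion fun z _ => hm z
    have hδ0 : 0 ≤ δ n := (abs_nonneg _).trans (hg n 0)
    have hvol : ∀ c : ℝ, 0 ≤ c → ∀ z : Fin d → ℤ, ∫⁻ _ in latticeCube s (e n 0) z, ENNReal.ofReal c
        = ENNReal.ofReal (c * s ^ d) := by
      intro c hc z
      rw [setLIntegral_const, volume_latticeCube, ENNReal.ofReal_mul hc, ENNReal.ofReal_pow hs.le]
    have hsd : 0 < s ^ d := pow_pos hs d
    have hα : 0 < α := by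
      by_contra h
      have := mul_nonpos_of_nonpos_of_nonneg (not_lt.1 h) hsd.le
      linarith
    rw [← Measure.map_apply (he n).1.continuous.measurable hm', hmap,
      measure_biUnion_finset (fun z _ w _ hzw => disjoint_latticeCube hs _ hzw) fun z _ => hm z]
    constructor
    · rcases le_or_gt 0 (α - δ n) with hpos | hneg
      · have hle : ∀ z ∈ T, ENNReal.ofReal ((α - δ n) * s ^ d)
            ≤ (volume.withDensity fun x => ENNReal.ofReal (g n x)) (latticeCube s (e n 0) z) := by
          intro z _
          rw [withDensity_apply _ (hm z), ← hvol _ hpos z]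
          exact lintegral_mono fun x => ENNReal.ofReal_le_ofReal (by linarith [abs_le.1 (hg n x)])
        refine le_trans (le_of_eq ?_) (Finset.sum_le_sum hle)
        rw [Finset.sum_const, nsmul_eq_mul, ENNReal.ofReal_mul (by positivity),
          ENNReal.ofReal_natCast, sub_mul, hsα]
      · rw [ENNReal.ofReal_of_nonpos]
        · exact bot_le
        · refine mul_nonpos_of_nonneg_of_nonpos (by positivity) ?_
          rw [← hsα, ← sub_mul]
          exact mul_nonpos_of_nonpos_of_nonneg hneg.le hsd.le
    · have hle : ∀ z ∈ T, (volume.withDensity fun x => ENNReal.ofReal (g n x))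
            (latticeCube s (e n 0) z) ≤ ENNReal.ofReal ((α + δ n) * s ^ d) := by
        intro z _
        rw [withDensity_apply _ (hm z), ← hvol _ (by positivity) z]
        exact lintegral_mono fun x => ENNReal.ofReal_le_ofReal (by linarith [abs_le.1 (hg n x)])
      refine (Finset.sum_le_sum hle).trans (le_of_eq ?_)
      rw [Finset.sum_const, nsmul_eq_mul, add_mul, hsα, ENNReal.ofReal_mul (by positivity),
        ENNReal.ofReal_natCast]
  have hm' : ∀ n (T : Finset (Fin d → ℤ)),
      MeasurableSet (e n ⁻¹' ⋃ z ∈ T, latticeCube s (e n 0) z) := fun n T =>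
    (he n).1.continuous.measurable (T.measurableSet_biUnion fun z _ => measurableSet_iocCube _ _)
  have hfin₁ : ∀ p : D, {z : Fin d → ℤ | dist (f p) (fun i => s * z i) ≤ M}.Finite := fun p =>
    finite_setOf_dist_lattice_le hs _ _
  have hball : ∀ ρ : ℝ, {p : D | dist (p : Fin d → ℝ) 0 ≤ ρ}.Finite := by
    intro ρ
    refine Set.Finite.of_finite_image (f := Subtype.val) ?_ Subtype.val_injective.injOn
    refine (SeparatedBy.finite_inter_hbox hr hD (fun _ => -ρ - 1) (fun _ => ρ + 1)).subset ?_
    rintro _ ⟨p, hp, rfl⟩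
    refine ⟨p.2, mem_hbox.2 fun i => ?_⟩
    have h1 := (dist_le_pi_dist (p : Fin d → ℝ) 0 i).trans hp
    rw [Real.dist_eq, Pi.zero_apply, sub_zero] at h1
    have h2 := abs_le.1 h1
    constructor <;> linarith
  have hf0 : f 0 = 0 := by
    refine tendsto_nhds_unique (hlim 0) ?_
    simp only [he'a, sub_self]
    exact tendsto_const_nhds
  have hsymm : ∀ (F : (Fin d → ℝ) ≃ (Fin d → ℝ)), IsBiLip K F → F 0 = 0 → ∀ x,
      dist x 0 ≤ K * dist (F x) 0 := by
    intro F hF hF0 x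
    have := hF.2.dist_le_mul (F x) (F 0)
    rwa [F.symm_apply_apply, F.symm_apply_apply, hF0] at this
  have hfin₂ : ∀ z : Fin d → ℤ, {p : D | dist (f p) (fun i => s * z i) ≤ M}.Finite := by
    intro z
    refine (hball (K * (M + dist (fun i => s * (z i : ℝ)) 0))).subset fun p hp => ?_
    refine (hsymm f hf hf0 p).trans (mul_le_mul_of_nonneg_left ?_ K.2)
    exact (dist_triangle _ _ _).trans (add_le_add_left hp _)
  obtain ⟨a, ha, ha'⟩ := (Finset.all_card_le_biUnion_card_iff_exists_injective
    (fun p : D => (hfin₁ p).toFinset)).1 (by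
      intro S
      set T := S.biUnion fun p : D => (hfin₁ p).toFinset with hT
      have hev : ∀ᶠ n in (Filter.hyperfilter ℕ : Filter ℕ), ∀ p ∈ S, dist (e' n p) (f p) ≤ 1 :=
        (Filter.eventually_all_finset S).2 fun p _ => hclose p
      have hle : ∀ᶠ n in (Filter.hyperfilter ℕ : Filter ℕ),
          (S.card : ℝ) ≤ T.card * (1 + δ n * s ^ d) := by
        filter_upwards [hev] with n hn
        have h1 := hμ₁ (S.map (Embedding.subtype _)) (e n ⁻¹' ⋃ z ∈ T, latticeCube s (e n 0) z)
          (by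
            intro p hp
            simp only [Finset.coe_map, mem_image] at hp
            obtain ⟨q, -, rfl⟩ := hp
            exact q.2) (hm' n T) (by
            intro p hp x hx
            obtain ⟨q, hq, rfl⟩ := Finset.mem_map.1 hp
            obtain ⟨z, hz⟩ := exists_mem_latticeCube hs (e n 0) (e n x)
            refine mem_iUnion₂.2 ⟨z, Finset.mem_biUnion.2 ⟨q, hq, ?_⟩, hz⟩
            exact (hfin₁ q).mem_toFinset.2 (hnear n q x z (hn q hq) hx hz))
        have h2 := h1.trans (hcube n T).2
        have hδ0 : 0 ≤ δ n := (abs_nonneg _).trans (hg n 0)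
        rw [Finset.card_map, ← ENNReal.ofReal_natCast,
          ENNReal.ofReal_le_ofReal_iff (by positivity)] at h2
        exact h2
      have h3 : Filter.Tendsto (fun n => (T.card : ℝ) * (1 + δ n * s ^ d)) (Filter.hyperfilter ℕ)
          (nhds (T.card * (1 + 0 * s ^ d))) :=
        ((hδ'.mul_const _).const_add 1).const_mul _
      have h4 := ge_of_tendsto h3 hle
      rw [zero_mul, add_zero, mul_one] at h4
      exact_mod_cast h4)
  obtain ⟨b, hb, hb'⟩ := (Finset.all_card_le_biUnion_card_iff_exists_injective
    (fun z : Fin d → ℤ => (hfin₂ z).toFinset)).1 (by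
      intro T
      set S := T.biUnion fun z => (hfin₂ z).toFinset with hS
      obtain ⟨ρ, hρ⟩ : ∃ ρ, ∀ z ∈ T, dist (fun i => s * (z i : ℝ)) 0 ≤ ρ := by
        refine ⟨∑ z ∈ T, dist (fun i => s * (z i : ℝ)) 0, fun z hz => ?_⟩
        exact Finset.single_le_sum (f := fun z : Fin d → ℤ => dist (fun i => s * (z i : ℝ)) 0)
          (fun _ _ => dist_nonneg) hz
      have hev : ∀ᶠ n in (Filter.hyperfilter ℕ : Filter ℕ),
          ∀ p ∈ (hball (K * (K * L + s + ρ))).toFinset, dist (e' n p) (f p) ≤ 1 :=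
        (Filter.eventually_all_finset _).2 fun p _ => hclose p
      have hle : ∀ᶠ n in (Filter.hyperfilter ℕ : Filter ℕ),
          (T.card : ℝ) * (1 - δ n * s ^ d) ≤ S.card := by
        filter_upwards [hev] with n hn
        have h1 := hμ₂ (S.map (Embedding.subtype _)) (e n ⁻¹' ⋃ z ∈ T, latticeCube s (e n 0) z)
          (by
            intro p hp
            simp only [Finset.coe_map, mem_image] at hp
            obtain ⟨q, -, rfl⟩ := hp
            exact q.2) (hm' n T) (by
            intro p hp x hx hpx
            obtain ⟨z, hzT, hz⟩ := mem_iUnion₂.1 hx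
            refine Finset.mem_map.2 ⟨⟨p, hp⟩, Finset.mem_biUnion.2 ⟨z, hzT, ?_⟩, rfl⟩
            refine (hfin₂ z).mem_toFinset.2 (hnear n p x z (hn ⟨p, hp⟩ ?_) hpx hz)
            refine (hball _).mem_toFinset.2 ?_
            refine (hsymm (e' n) (hbi n) (by rw [he'a, sub_self]) p).trans
              (mul_le_mul_of_nonneg_left ?_ K.2)
            have h4 := dist_le_of_mem_latticeCube hs hz
            have h5 := ((hbi n).1.dist_le_mul p x).trans (mul_le_mul_of_nonneg_left hpx K.2)
            have h6 := dist_triangle4 (e' n p) (e' n x) (fun i => s * (z i : ℝ)) 0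
            have h7 := hρ z hzT
            rw [← he'a] at h4
            linarith)
        have h2 := (hcube n T).1.trans h1
        rw [Finset.card_map, ← ENNReal.ofReal_natCast,
          ENNReal.ofReal_le_ofReal_iff (by positivity)] at h2
        exact h2
      have h3 : Filter.Tendsto (fun n => (T.card : ℝ) * (1 - δ n * s ^ d)) (Filter.hyperfilter ℕ)
          (nhds (T.card * (1 - 0 * s ^ d))) :=
        ((hδ'.mul_const _).const_sub 1).const_mul _
      have h4 := le_of_tendsto h3 hle
      rw [zero_mul, sub_zero, mul_one] at h4
      exact_mod_cast h4)
  obtain ⟨φ, hφ, hφ'⟩ := Function.Embedding.schroeder_bernstein_of_rel ha hb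
    (fun p z => dist (f p) (fun i => s * z i) ≤ M)
    (fun p => (hfin₁ p).mem_toFinset.1 (ha' p)) (fun z => (hfin₂ z).mem_toFinset.1 (hb' z))
  exact ⟨f, Equiv.ofBijective φ hφ, M, hf, hφ'⟩

theorem exists_isBiLip_smul {E : Type*} [NormedAddCommGroup E] [NormedSpace ℝ E] {c : ℝ}
    (hc : 0 < c) : ∃ (K : ℝ≥0) (e : E ≃ E), IsBiLip K e ∧ ∀ x, e x = c • x := by
  have hc' : 0 < c⁻¹ := inv_pos.2 hc
  refine ⟨max c.toNNReal c⁻¹.toNNReal, ⟨fun x => c • x, fun x => c⁻¹ • x, fun x => ?_, fun x => ?_⟩,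
    ⟨?_, ?_⟩, fun x => rfl⟩
  · simp [smul_smul, hc.ne']
  · simp [smul_smul, hc.ne']
  · refine LipschitzWith.of_dist_le_mul fun x y => ?_
    change dist (c • x) (c • y) ≤ _
    rw [dist_smul₀, Real.norm_of_nonneg hc.le]
    refine mul_le_mul_of_nonneg_right ?_ dist_nonneg
    rw [NNReal.coe_max, Real.coe_toNNReal _ hc.le]
    exact le_max_left _ _
  · refine LipschitzWith.of_dist_le_mul fun x y => ?_
    change dist (c⁻¹ • x) (c⁻¹ • y) ≤ _
    rw [dist_smul₀, Real.norm_of_nonneg hc'.le]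
    refine mul_le_mul_of_nonneg_right ?_ dist_nonneg
    rw [NNReal.coe_max, Real.coe_toNNReal _ hc'.le]
    exact le_max_right _ _

/-- A linearly repetitive Delone set is mapped by a bi-Lipschitz homeomorphism to within bounded
distance of the integer lattice. -/
theorem exists_isBiLip_near_lattice {d : ℕ} (hd : 1 ≤ d) {r R C : ℝ} {D : Set (Fin d → ℝ)}
    (hr : 0 < r) (hD : SeparatedBy r D) (hR : ∀ x, ∃ y ∈ D, dist x y ≤ R)
    (hC : CubeRepetitive C D) :
    ∃ (K : ℝ≥0) (f : (Fin d → ℝ) ≃ (Fin d → ℝ)) (φ : D ≃ (Fin d → ℤ)) (M : ℝ), IsBiLip K f ∧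
      ∀ p : D, dist (f p) (fun i => (φ p i : ℝ)) ≤ M := by
  obtain ⟨α, L, K, δ, g, e, hα, hL, hδ, he, hg, hmap⟩ := exists_transport_sequence hd hr hD hR hC
  set s : ℝ := (α⁻¹) ^ ((d : ℝ)⁻¹) with hs
  have hs0 : 0 < s := Real.rpow_pos_of_pos (inv_pos.2 hα) _
  have hsd : α * s ^ d = 1 := by
    rw [hs, Real.rpow_inv_natCast_pow (inv_pos.2 hα).le (by omega), mul_inv_cancel₀ hα.ne']
  obtain ⟨f, φ, M, hf, hφ⟩ := exists_equiv_lattice hr hD hs0 hsd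
    (μ := volume.withDensity fun x => ENNReal.ofReal (pointDensity D (fun _ => L) x)) (L := L)
    (fun S B hS hB h => by
      rw [withDensity_apply _ hB]
      exact card_le_setLIntegral_pointDensity hr hD hL hS h)
    (fun S B hS hB h => by
      rw [withDensity_apply _ hB]
      exact setLIntegral_pointDensity_le_card hL hS hB h) hδ he hg hmap
  obtain ⟨K', m, hm, hmx⟩ := exists_isBiLip_smul (E := Fin d → ℝ) (inv_pos.2 hs0)
  refine ⟨K * K', f.trans m, φ, s⁻¹ * M, hf.trans hm, fun p => ?_⟩
  have h1 : (fun i => (φ p i : ℝ)) = s⁻¹ • fun i => s * (φ p i : ℝ) := by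
    funext i
    simp [hs0.ne']
  rw [h1, Equiv.trans_apply, hmx, dist_smul₀, Real.norm_of_nonneg (inv_pos.2 hs0).le]
  exact mul_le_mul_of_nonneg_left (hφ p) (inv_pos.2 hs0).le

/-- Bi-Lipschitz homeomorphisms with disjoint supports can be glued. -/
theorem exists_isBiLip_glue {ι E : Type*} [NormedAddCommGroup E] {A : ι → Set E} {K : ℝ≥0}
    {T : ι → E ≃ E} (hA : ∀ i j x, x ∈ A i → x ∈ A j → i = j) (hT : ∀ i, IsBiLip K (T i))
    (hs : ∀ i x, x ∉ A i → T i x = x) :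
    ∃ G : E ≃ E, IsBiLip (2 * K + 3) G ∧ (∀ i x, x ∈ A i → G x = T i x) ∧
      ∀ x, (∀ i, x ∉ A i) → G x = x := by
  classical
  have hglue : ∀ S : ι → E ≃ E, (∀ i, LipschitzWith K (S i)) → (∀ i x, x ∉ A i → S i x = x) →
      ∃ F : E → E, LipschitzWith (2 * K + 3) F ∧ (∀ i x, x ∈ A i → F x = S i x) ∧
        ∀ x, (∀ i, x ∉ A i) → F x = x := by
    intro S hS hfix
    set F : E → E := fun x => if h : ∃ i, x ∈ A i then S h.choose x else x with hF
    have h1 : ∀ i x, x ∈ A i → F x = S i x := by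
      intro i x hx
      have hex : ∃ i, x ∈ A i := ⟨i, hx⟩
      simp only [hF, dif_pos hex]
      rw [hA _ _ x hex.choose_spec hx]
    have h2 : ∀ x, (∀ i, x ∉ A i) → F x = x := by
      intro x hx
      simp only [hF]
      rw [dif_neg]
      push Not
      exact hx
    have hdisp : ∀ i x y, y ∉ A i → ‖S i x - x‖ ≤ (K + 1) * dist x y := by
      intro i x y hy
      have h3 := (hS i).dist_le_mul x y
      rw [hfix i y hy, dist_eq_norm] at h3
      have h4 : S i x - x = (S i x - y) - (x - y) := by abel
      rw [h4, dist_eq_norm] at *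
      linarith [norm_sub_le (S i x - y) (x - y)]
    refine ⟨F, LipschitzWith.of_dist_le_mul fun x y => ?_, h1, h2⟩
    have hd : 0 ≤ dist x y := dist_nonneg
    have hK : (0 : ℝ) ≤ K := K.2
    have hstep : ∀ x y, (∀ i, x ∈ A i → y ∉ A i) → ‖F x - x‖ ≤ (K + 1) * dist x y := by
      intro x y hxy
      by_cases hx : ∃ i, x ∈ A i
      · obtain ⟨i, hi⟩ := hx
        rw [h1 i x hi]
        exact hdisp i x y (hxy i hi)
      · push Not at hx
        rw [h2 x hx, sub_self, norm_zero]
        positivity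
    by_cases hcommon : ∃ i, x ∈ A i ∧ y ∈ A i
    · obtain ⟨i, hx, hy⟩ := hcommon
      rw [h1 i x hx, h1 i y hy]
      refine ((hS i).dist_le_mul x y).trans (mul_le_mul_of_nonneg_right ?_ hd)
      push_cast
      linarith
    · push Not at hcommon
      have h3 := hstep x y hcommon
      have h4 := hstep y x fun i hy hx => hcommon i hx hy
      rw [dist_comm y x] at h4
      have h5 : F x - F y = (F x - x) - (F y - y) + (x - y) := by abel
      have h6 := norm_add_le ((F x - x) - (F y - y)) (x - y)
      have h7 := norm_sub_le (F x - x) (F y - y)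
      rw [dist_eq_norm (F x), h5]
      push_cast
      rw [← dist_eq_norm x y] at h6
      linarith
  have hmem : ∀ i x, x ∈ A i → T i x ∈ A i := by
    intro i x hx
    by_contra h
    have h1 := (T i).injective (hs i _ h)
    rw [h1] at h
    exact h hx
  have hs' : ∀ i x, x ∉ A i → (T i).symm x = x := fun i x hx => by
    rw [Equiv.symm_apply_eq, hs i x hx]
  have hmem' : ∀ i x, x ∈ A i → (T i).symm x ∈ A i := by
    intro i x hx
    by_contra h
    have h1 := hs i _ h
    rw [Equiv.apply_symm_apply] at h1
    rw [← h1] at h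
    exact h hx
  obtain ⟨F, hF, hF1, hF2⟩ := hglue T (fun i => (hT i).1) hs
  obtain ⟨G, hG, hG1, hG2⟩ := hglue (fun i => (T i).symm) (fun i => (hT i).2) hs'
  refine ⟨⟨F, G, fun x => ?_, fun x => ?_⟩, ⟨hF, hG⟩, hF1, hF2⟩
  · by_cases hx : ∃ i, x ∈ A i
    · obtain ⟨i, hi⟩ := hx
      rw [hF1 i x hi, hG1 i _ (hmem i x hi), Equiv.symm_apply_apply]
    · push Not at hx
      rw [hF2 x hx, hG2 x hx]
  · by_cases hx : ∃ i, x ∈ A i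
    · obtain ⟨i, hi⟩ := hx
      rw [hG1 i x hi, hF1 i _ (hmem' i x hi), Equiv.apply_symm_apply]
    · push Not at hx
      rw [hG2 x hx, hF2 x hx]

/-- The integer vector `w` as a real vector. -/
def latticePoint {d : ℕ} (w : Fin d → ℤ) : Fin d → ℝ := fun i => w i

theorem latticePoint_add {d : ℕ} (v w : Fin d → ℤ) :
    latticePoint (v + w) = latticePoint v + latticePoint w := by
  funext i
  simp [latticePoint]

/-- There is a compactly supported bi-Lipschitz homeomorphism acting on the integer lattice as the
transposition of `a` and `b`. -/
def HasLatticeSwap {d : ℕ} (a b : Fin d → ℤ) : Prop :=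
  ∃ (T : (Fin d → ℝ) ≃ (Fin d → ℝ)) (K : ℝ≥0) (ρ : ℝ), IsBiLip K T ∧
    (∀ w, T (latticePoint w) = latticePoint (Equiv.swap a b w)) ∧ ∀ x, ρ ≤ ‖x‖ → T x = x

theorem HasLatticeSwap.refl {d : ℕ} (a : Fin d → ℤ) : HasLatticeSwap a a :=
  ⟨Equiv.refl _, 1, 0, IsBiLip.refl, fun w => by simp, fun x _ => rfl⟩

theorem HasLatticeSwap.symm {d : ℕ} {a b : Fin d → ℤ} (h : HasLatticeSwap a b) :
    HasLatticeSwap b a := by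
  obtain ⟨T, K, ρ, hT, hw, hx⟩ := h
  exact ⟨T, K, ρ, hT, fun w => by rw [hw, Equiv.swap_comm], hx⟩

theorem HasLatticeSwap.trans {d : ℕ} {a b c : Fin d → ℤ} (h : HasLatticeSwap a b)
    (h' : HasLatticeSwap b c) : HasLatticeSwap a c := by
  rcases eq_or_ne a b with rfl | hab
  · exact h'
  rcases eq_or_ne a c with rfl | hac
  · exact HasLatticeSwap.refl a
  obtain ⟨T, K, ρ, hT, hw, hx⟩ := h
  obtain ⟨T', K', ρ', hT', hw', hx'⟩ := h'
  refine ⟨(T'.trans T).trans T', K' * K * K', max ρ ρ', (hT'.trans hT).trans hT', fun w => ?_,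
    fun x hxx => ?_⟩
  · simp only [Equiv.trans_apply]
    rw [hw', hw, hw', ← Equiv.Perm.mul_apply, ← Equiv.Perm.mul_apply,
      Equiv.swap_mul_swap_mul_swap hab hac, Equiv.swap_comm]
  · simp only [Equiv.trans_apply]
    rw [hx' x ((le_max_right _ _).trans hxx), hx x ((le_max_left _ _).trans hxx),
      hx' x ((le_max_right _ _).trans hxx)]

theorem IsBiLip.conj_add {E : Type*} [NormedAddCommGroup E] {K : ℝ≥0} {T : E ≃ E}
    (h : IsBiLip K T) (c : E) :
    IsBiLip K (((Equiv.subRight c).trans T).trans (Equiv.addRight c)) := by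
  constructor
  · refine LipschitzWith.of_dist_le_mul fun x y => ?_
    have := h.1.dist_le_mul (x - c) (y - c)
    rw [dist_sub_right] at this
    change dist (T (x - c) + c) (T (y - c) + c) ≤ _
    rwa [dist_add_right]
  · refine LipschitzWith.of_dist_le_mul fun x y => ?_
    have := h.2.dist_le_mul (x - c) (y - c)
    rw [dist_sub_right] at this
    change dist (T.symm (x + -c) + c) (T.symm (y + -c) + c) ≤ _
    rwa [dist_add_right, ← sub_eq_add_neg, ← sub_eq_add_neg]

theorem swap_add_right {d : ℕ} (a b c w : Fin d → ℤ) :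
    Equiv.swap (a + c) (b + c) w = Equiv.swap a b (w - c) + c := by
  simp only [Equiv.swap_apply_def, sub_eq_iff_eq_add]
  split_ifs <;> simp

theorem HasLatticeSwap.add_right {d : ℕ} {a b : Fin d → ℤ} (h : HasLatticeSwap a b)
    (c : Fin d → ℤ) : HasLatticeSwap (a + c) (b + c) := by
  obtain ⟨T, K, ρ, hT, hw, hx⟩ := h
  refine ⟨_, K, ρ + ‖latticePoint c‖, hT.conj_add (latticePoint c), fun w => ?_, fun x hxx => ?_⟩
  · change T (latticePoint w - latticePoint c) + latticePoint c = _
    have h1 : latticePoint w - latticePoint c = latticePoint (w - c) := by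
      rw [sub_eq_iff_eq_add, ← latticePoint_add, sub_add_cancel]
    rw [h1, hw, swap_add_right, latticePoint_add]
  · change T (x - latticePoint c) + latticePoint c = x
    rw [hx, sub_add_cancel]
    linarith [norm_sub_norm_le x (latticePoint c)]

/-- Squared Euclidean distance to the midpoint of `0` and the `j`-th basis vector. -/
noncomputable def twistRadius {d : ℕ} (j : Fin d) (x : Fin d → ℝ) : ℝ :=
  ∑ i, (x i - Pi.single (M := fun _ => ℝ) j (1 / 2) i) ^ 2

/-- The angle of rotation of the twist, as a function of position. -/
noncomputable def twistAngle {d : ℕ} (j : Fin d) (s : ℝ) (x : Fin d → ℝ) : ℝ :=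
  s * (Real.pi * Real.smoothTransition (5 / 4 - twistRadius j x))

/-- The displacement of the twist exchanging `0` and the `j`-th basis vector. -/
noncomputable def twistDisp {d : ℕ} (j l : Fin d) (s : ℝ) (x : Fin d → ℝ) : Fin d → ℝ :=
  ((Real.cos (twistAngle j s x) - 1) * (x j - 1 / 2) - Real.sin (twistAngle j s x) * x l) •
      Pi.single (M := fun _ => ℝ) j 1 +
    (Real.sin (twistAngle j s x) * (x j - 1 / 2) + (Real.cos (twistAngle j s x) - 1) * x l) •
      Pi.single (M := fun _ => ℝ) l 1

theorem twistRadius_add {d : ℕ} {j l : Fin d} (hjl : j ≠ l) (x : Fin d → ℝ) {a b : ℝ}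
    (h : (x j + a - 1 / 2) ^ 2 + (x l + b) ^ 2 = (x j - 1 / 2) ^ 2 + (x l) ^ 2) :
    twistRadius j (x + (a • Pi.single (M := fun _ => ℝ) j 1 +
      b • Pi.single (M := fun _ => ℝ) l 1)) = twistRadius j x := by
  unfold twistRadius
  have hl : l ∈ Finset.univ.erase j := by simp [hjl.symm]
  rw [← Finset.add_sum_erase _ _ (Finset.mem_univ j), ← Finset.add_sum_erase _ _ hl,
    ← Finset.add_sum_erase Finset.univ (fun i => (x i - _) ^ 2) (Finset.mem_univ j),
    ← Finset.add_sum_erase (Finset.univ.erase j) (fun i => (x i - _) ^ 2) hl]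
  have h1 : ∑ i ∈ (Finset.univ.erase j).erase l, ((x + (a • Pi.single (M := fun _ => ℝ) j 1 +
      b • Pi.single (M := fun _ => ℝ) l 1)) i - Pi.single (M := fun _ => ℝ) j (1 / 2) i) ^ 2 =
      ∑ i ∈ (Finset.univ.erase j).erase l, (x i - Pi.single (M := fun _ => ℝ) j (1 / 2) i) ^ 2 := by
    refine Finset.sum_congr rfl fun i hi => ?_
    simp only [Finset.mem_erase, Finset.mem_univ, and_true] at hi
    simp [Pi.single_eq_of_ne hi.1, Pi.single_eq_of_ne hi.2]
  rw [h1]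
  simp [Pi.single_eq_of_ne hjl, Pi.single_eq_of_ne hjl.symm]
  norm_num at h ⊢
  linarith

theorem twistDisp_apply_left {d : ℕ} {j l : Fin d} (hjl : j ≠ l) (s : ℝ) (x : Fin d → ℝ) :
    twistDisp j l s x j = (Real.cos (twistAngle j s x) - 1) * (x j - 1 / 2) -
      Real.sin (twistAngle j s x) * x l := by
  simp [twistDisp, Pi.single_eq_of_ne hjl]

theorem twistDisp_apply_right {d : ℕ} {j l : Fin d} (hjl : j ≠ l) (s : ℝ) (x : Fin d → ℝ) :
    twistDisp j l s x l = Real.sin (twistAngle j s x) * (x j - 1 / 2) +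
      (Real.cos (twistAngle j s x) - 1) * x l := by
  simp [twistDisp, Pi.single_eq_of_ne hjl.symm]

theorem twistDisp_apply_of_ne {d : ℕ} {j l i : Fin d} (hj : i ≠ j) (hl : i ≠ l) (s : ℝ)
    (x : Fin d → ℝ) : twistDisp j l s x i = 0 := by
  simp [twistDisp, Pi.single_eq_of_ne hj, Pi.single_eq_of_ne hl]

theorem twistRadius_add_twistDisp {d : ℕ} {j l : Fin d} (hjl : j ≠ l) (s : ℝ) (x : Fin d → ℝ) :
    twistRadius j (x + twistDisp j l s x) = twistRadius j x := by
  refine twistRadius_add hjl x ?_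
  have := Real.sin_sq_add_cos_sq (twistAngle j s x)
  linear_combination ((x j - 1 / 2) ^ 2 + (x l) ^ 2) * this

theorem twistDisp_neg_add {d : ℕ} {j l : Fin d} (hjl : j ≠ l) (s : ℝ) (x : Fin d → ℝ) :
    x + twistDisp j l s x + twistDisp j l (-s) (x + twistDisp j l s x) = x := by
  have hθ : twistAngle j (-s) (x + twistDisp j l s x) = -twistAngle j s x := by
    unfold twistAngle
    rw [twistRadius_add_twistDisp hjl]
    ring
  have := Real.sin_sq_add_cos_sq (twistAngle j s x)
  funext i
  by_cases hj : i = j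
  · subst hj
    rw [Pi.add_apply, twistDisp_apply_left hjl (-s), hθ, Real.cos_neg, Real.sin_neg]
    simp only [Pi.add_apply, twistDisp_apply_left hjl, twistDisp_apply_right hjl]
    linear_combination (x i - 1 / 2) * this
  by_cases hl : i = l
  · subst hl
    rw [Pi.add_apply, twistDisp_apply_right hjl (-s), hθ, Real.cos_neg, Real.sin_neg]
    simp only [Pi.add_apply, twistDisp_apply_left hjl, twistDisp_apply_right hjl]
    linear_combination x i * this
  · simp [twistDisp_apply_of_ne hj hl]

theorem twistDisp_eq_zero {d : ℕ} {j l : Fin d} {s : ℝ} {x : Fin d → ℝ}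
    (h : 5 / 4 ≤ twistRadius j x) : twistDisp j l s x = 0 := by
  have : twistAngle j s x = 0 := by
    rw [twistAngle, Real.smoothTransition.zero_of_nonpos (by linarith)]
    simp
  simp [twistDisp, this]

theorem contDiff_twistDisp {d : ℕ} (j l : Fin d) (s : ℝ) : ContDiff ℝ 1 (twistDisp j l s) := by
  have hQ : ContDiff ℝ 1 (twistRadius j) := by
    unfold twistRadius
    fun_prop
  have hθ : ContDiff ℝ 1 (twistAngle j s) := by
    unfold twistAngle
    exact contDiff_const.mul (contDiff_const.mul
      (Real.smoothTransition.contDiff.comp (contDiff_const.sub hQ)))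
  unfold twistDisp
  have := Real.contDiff_cos.comp hθ
  have := Real.contDiff_sin.comp hθ
  simp only [comp_def] at *
  fun_prop

theorem twistRadius_ge_of_norm {d : ℕ} (j : Fin d) {x : Fin d → ℝ} (hx : 2 ≤ ‖x‖) :
    5 / 4 ≤ twistRadius j x := by
  by_contra! h
  have h1 : ‖x‖ ≤ 7 / 4 := by
    refine (pi_norm_le_iff_of_nonneg (by norm_num)).2 fun i => ?_
    have h2 : (x i - Pi.single (M := fun _ => ℝ) j (1 / 2) i) ^ 2 ≤ twistRadius j x :=
      Finset.single_le_sum (f := fun i => (x i - Pi.single (M := fun _ => ℝ) j (1 / 2) i) ^ 2)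
        (fun i _ => sq_nonneg _) (Finset.mem_univ i)
    have h3 : 0 ≤ Pi.single (M := fun _ => ℝ) j (1 / 2) i ∧
        Pi.single (M := fun _ => ℝ) j (1 / 2) i ≤ 1 / 2 := by
      rw [Pi.single_apply]
      split_ifs <;> norm_num
    rw [Real.norm_eq_abs, abs_le]
    constructor <;> nlinarith
  linarith

theorem exists_lipschitzWith_twistDisp {d : ℕ} (j l : Fin d) (s : ℝ) :
    ∃ K, LipschitzWith K (twistDisp j l s) := by
  refine ContDiff.lipschitzWith_of_hasCompactSupport (𝕂 := ℝ) ?_ (contDiff_twistDisp j l s)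
    one_ne_zero
  refine HasCompactSupport.intro (isCompact_closedBall 0 2) fun x hx => ?_
  rw [mem_closedBall_zero_iff, not_le] at hx
  exact twistDisp_eq_zero (twistRadius_ge_of_norm j hx.le)

theorem twistRadius_latticePoint_ge {d : ℕ} {j : Fin d} {w : Fin d → ℤ} (h0 : w ≠ 0)
    (h1 : w ≠ Pi.single j 1) : 5 / 4 ≤ twistRadius j (latticePoint w) := by
  unfold twistRadius
  have hj : (1 / 4 : ℝ) ≤ ((w j : ℝ) - 1 / 2) ^ 2 := by
    rcases le_or_gt (w j) 0 with h | h
    · have : (w j : ℝ) ≤ 0 := by exact_mod_cast h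
      nlinarith
    · have : (1 : ℝ) ≤ w j := by exact_mod_cast h
      nlinarith
  by_cases hw : ∃ i, i ≠ j ∧ w i ≠ 0
  · obtain ⟨i, hij, hi⟩ := hw
    have h2 : (1 : ℝ) ≤ (w i : ℝ) ^ 2 := by
      have : 1 ≤ (w i) ^ 2 := Int.add_one_le_iff.2 (sq_pos_of_ne_zero hi)
      exact_mod_cast this
    have h3 : ∑ k ∈ {j, i}, (latticePoint w k - Pi.single (M := fun _ => ℝ) j (1 / 2) k) ^ 2 ≤
        ∑ k, (latticePoint w k - Pi.single (M := fun _ => ℝ) j (1 / 2) k) ^ 2 :=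
      Finset.sum_le_sum_of_subset_of_nonneg (Finset.subset_univ _) fun _ _ _ => sq_nonneg _
    rw [Finset.sum_pair hij.symm, Pi.single_eq_same, Pi.single_eq_of_ne hij] at h3
    simp only [latticePoint] at h3 ⊢
    linarith
  · push Not at hw
    have h2 : w j ≠ 0 := fun h => h0 (funext fun i => by
      by_cases hi : i = j
      · rw [hi, h, Pi.zero_apply]
      · exact hw i hi)
    have h3 : w j ≠ 1 := fun h => h1 (funext fun i => by
      by_cases hi : i = j
      · rw [hi, h, Pi.single_eq_same]
      · rw [hw i hi, Pi.single_eq_of_ne hi])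
    have h4 : (5 / 4 : ℝ) ≤ ((w j : ℝ) - 1 / 2) ^ 2 := by
      rcases lt_or_ge (w j) 0 with h | h
      · have : (w j : ℝ) ≤ -1 := by exact_mod_cast (by omega : w j ≤ -1)
        nlinarith
      · have : (2 : ℝ) ≤ w j := by exact_mod_cast (by omega : 2 ≤ w j)
        nlinarith
    have h5 := Finset.single_le_sum
      (f := fun i => (latticePoint w i - Pi.single (M := fun _ => ℝ) j (1 / 2) i) ^ 2)
      (fun i _ => sq_nonneg _) (Finset.mem_univ j)
    simp only [latticePoint, Pi.single_eq_same] at h5 ⊢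
    linarith

theorem twistDisp_zero {d : ℕ} {j l : Fin d} :
    twistDisp j l 1 0 = Pi.single j 1 := by
  have hQ : twistRadius j (0 : Fin d → ℝ) = 1 / 4 := by
    unfold twistRadius
    rw [Finset.sum_eq_single j (fun i _ hi => by simp [Pi.single_eq_of_ne hi]) (by simp)]
    norm_num
  have hθ : twistAngle j 1 (0 : Fin d → ℝ) = Real.pi := by
    rw [twistAngle, hQ, Real.smoothTransition.one_of_one_le (by norm_num)]
    ring
  simp only [twistDisp, hθ, Real.cos_pi, Real.sin_pi, Pi.zero_apply]
  norm_num

theorem twistDisp_single {d : ℕ} {j l : Fin d} (hjl : j ≠ l) :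
    twistDisp j l 1 (Pi.single j 1) = -Pi.single j 1 := by
  have hQ : twistRadius j (Pi.single j 1 : Fin d → ℝ) = 1 / 4 := by
    unfold twistRadius
    rw [Finset.sum_eq_single j (fun i _ hi => by simp [Pi.single_eq_of_ne hi]) (by simp)]
    norm_num
  have hθ : twistAngle j 1 (Pi.single j 1 : Fin d → ℝ) = Real.pi := by
    rw [twistAngle, hQ, Real.smoothTransition.one_of_one_le (by norm_num)]
    ring
  simp only [twistDisp, hθ, Real.cos_pi, Real.sin_pi, Pi.single_eq_same,
    Pi.single_eq_of_ne hjl.symm]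
  norm_num

theorem hasLatticeSwap_single {d : ℕ} {j l : Fin d} (hjl : j ≠ l) :
    HasLatticeSwap (0 : Fin d → ℤ) (Pi.single j 1) := by
  obtain ⟨K, hK⟩ := exists_lipschitzWith_twistDisp j l 1
  obtain ⟨K', hK'⟩ := exists_lipschitzWith_twistDisp j l (-1)
  have hinv := twistDisp_neg_add hjl (-1)
  rw [neg_neg] at hinv
  have h0 : latticePoint (0 : Fin d → ℤ) = 0 := by
    funext i
    simp [latticePoint]
  have h1 : latticePoint (Pi.single j 1 : Fin d → ℤ) = Pi.single j 1 := by
    funext i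
    simp only [latticePoint, Pi.single_apply]
    split_ifs <;> simp
  refine ⟨⟨fun x => x + twistDisp j l 1 x, fun x => x + twistDisp j l (-1) x,
    twistDisp_neg_add hjl 1, hinv⟩, max (1 + K) (1 + K'), 2,
    ⟨(LipschitzWith.id.add hK).weaken (le_max_left _ _),
      (LipschitzWith.id.add hK').weaken (le_max_right _ _)⟩, fun w => ?_, fun x hx => ?_⟩
  · change latticePoint w + twistDisp j l 1 (latticePoint w) = _
    by_cases hw0 : w = 0
    · rw [hw0, Equiv.swap_apply_left, h0, h1, twistDisp_zero, zero_add]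
    by_cases hw1 : w = Pi.single j 1
    · rw [hw1, Equiv.swap_apply_right, h0, h1, twistDisp_single hjl, add_neg_cancel]
    · rw [Equiv.swap_apply_of_ne_of_ne hw0 hw1,
        twistDisp_eq_zero (twistRadius_latticePoint_ge hw0 hw1), add_zero]
  · change x + twistDisp j l 1 x = x
    rw [twistDisp_eq_zero (twistRadius_ge_of_norm j hx), add_zero]

theorem hasLatticeSwap_zero {d : ℕ} (hd : 2 ≤ d) (v : Fin d → ℤ) : HasLatticeSwap 0 v := by
  let H : AddSubgroup (Fin d → ℤ) :=
    { carrier := {v | HasLatticeSwap 0 v}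
      zero_mem' := HasLatticeSwap.refl 0
      add_mem' := fun {a b} ha hb => by
        have := HasLatticeSwap.add_right (show HasLatticeSwap 0 a from ha) b
        rw [zero_add] at this
        exact HasLatticeSwap.trans (show HasLatticeSwap 0 b from hb) this
      neg_mem' := fun {a} ha => by
        have := HasLatticeSwap.add_right (show HasLatticeSwap 0 a from ha) (-a)
        rw [zero_add, add_neg_cancel] at this
        exact this.symm }
  have hmem : ∀ j, Pi.single j 1 ∈ H := fun j => by
    have : Nontrivial (Fin d) := Fin.nontrivial_iff_two_le.2 hd
    obtain ⟨l, hl⟩ := exists_ne j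
    exact hasLatticeSwap_single hl.symm
  have hv : v ∈ H := by
    rw [← Finset.univ_sum_single v]
    refine sum_mem fun j _ => ?_
    have := H.zsmul_mem (hmem j) (v j)
    rwa [← Pi.single_smul', smul_eq_mul, mul_one] at this
  exact hv

theorem norm_latticePoint_sub_ge {d : ℕ} {v w : Fin d → ℤ} {m : ℝ} (i : Fin d)
    (h : m ≤ |((v i - w i : ℤ) : ℝ)|) : m ≤ ‖latticePoint v - latticePoint w‖ := by
  refine h.trans ?_
  have := norm_le_pi_norm (latticePoint v - latticePoint w) i
  rw [Real.norm_eq_abs] at this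
  simpa [latticePoint] using this

theorem exists_uniform_latticeSwap {d : ℕ} (hd : 2 ≤ d) (M : ℕ) :
    ∃ (K : ℝ≥0) (ρ : ℝ), ∀ v : Fin d → ℤ, (∀ i, |v i| ≤ M) →
      ∃ T : (Fin d → ℝ) ≃ (Fin d → ℝ), IsBiLip K T ∧
        (∀ w, T (latticePoint w) = latticePoint (Equiv.swap 0 v w)) ∧
          ∀ x, ρ ≤ ‖x‖ → T x = x := by
  choose T K ρ hT hw hx using hasLatticeSwap_zero (d := d) hd
  set S : Finset (Fin d → ℤ) := Fintype.piFinset fun _ => Finset.Icc (-(M : ℤ)) M with hS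
  have hSne : S.Nonempty := ⟨0, by simp [hS]⟩
  refine ⟨S.sup K, S.sup' hSne ρ, fun v hv => ⟨T v, (hT v).mono (Finset.le_sup ?_), hw v,
    fun x hxx => hx v x ((Finset.le_sup' ρ ?_).trans hxx)⟩⟩ <;>
  · rw [hS, Fintype.mem_piFinset]
    exact fun i => Finset.mem_Icc.2 (abs_le.1 (hv i))

/-- Moving one colour class of points. -/
theorem exists_move_sparse {d : ℕ} {ι : Type*} {K : ℝ≥0} {ρ : ℝ}
    {T : ι → (Fin d → ℝ) ≃ (Fin d → ℝ)} {a b : ι → Fin d → ℤ}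
    (hT : ∀ k, IsBiLip K (T k))
    (hw : ∀ k w, T k (latticePoint w) = latticePoint (Equiv.swap 0 (b k - a k) w))
    (hx : ∀ k x, ρ ≤ ‖x‖ → T k x = x)
    (hsep : ∀ k k', k ≠ k' → 2 * ρ ≤ ‖latticePoint (a k) - latticePoint (a k')‖) :
    ∃ G : (Fin d → ℝ) ≃ (Fin d → ℝ), IsBiLip (2 * K + 3) G ∧
      (∀ k, G (latticePoint (a k)) = latticePoint (b k)) ∧
      ∀ w, (∀ k, w ≠ a k ∧ w ≠ b k) → G (latticePoint w) = latticePoint w := by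
  set T' : ι → (Fin d → ℝ) ≃ (Fin d → ℝ) := fun k =>
    ((Equiv.subRight (latticePoint (a k))).trans (T k)).trans (Equiv.addRight (latticePoint (a k)))
    with hT'
  have hT'x : ∀ k x, T' k x = T k (x - latticePoint (a k)) + latticePoint (a k) :=
    fun k x => rfl
  have hT'w : ∀ k w, T' k (latticePoint w) = latticePoint (Equiv.swap (a k) (b k) w) := by
    intro k w
    have h1 : latticePoint w - latticePoint (a k) = latticePoint (w - a k) := by
      rw [sub_eq_iff_eq_add, ← latticePoint_add, sub_add_cancel]
    have h2 := swap_add_right 0 (b k - a k) (a k) w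
    rw [zero_add, sub_add_cancel] at h2
    rw [hT'x, h1, hw, h2, latticePoint_add]
  obtain ⟨G, hG, hG1, hG2⟩ := exists_isBiLip_glue
    (A := fun k => Metric.ball (latticePoint (a k)) ρ) (T := T') (K := K)
    (fun k k' x hk hk' => by
      by_contra hne
      have h1 := hsep k k' hne
      rw [← dist_eq_norm] at h1
      have h2 := dist_triangle_left (latticePoint (a k)) (latticePoint (a k')) x
      rw [Metric.mem_ball] at hk hk'
      linarith) (fun k => (hT k).conj_add _)
    (fun k x hk => by
      rw [Metric.mem_ball, not_lt, dist_eq_norm] at hk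
      rw [hT'x, hx k _ hk, sub_add_cancel])
  have key : ∀ w k, (latticePoint w ∈ Metric.ball (latticePoint (a k)) ρ) →
      G (latticePoint w) = latticePoint (Equiv.swap (a k) (b k) w) := fun w k h => by
    rw [hG1 k _ h, hT'w]
  refine ⟨G, hG, fun k => ?_, fun w hwk => ?_⟩
  · by_cases hk : latticePoint (a k) ∈ Metric.ball (latticePoint (a k)) ρ
    · rw [key _ k hk, Equiv.swap_apply_left]
    · have hρ : ρ ≤ 0 := by
        by_contra! h
        exact hk (Metric.mem_ball_self h)
      have h1 := hT'w k (a k)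
      rw [hT'x, hx k _ (hρ.trans (norm_nonneg _)), sub_add_cancel, Equiv.swap_apply_left] at h1
      rw [hG2 _ fun k' hk' => ?_, h1]
      rw [Metric.mem_ball] at hk'
      linarith [dist_nonneg (x := latticePoint (a k)) (y := latticePoint (a k'))]
  · by_cases hex : ∃ k, latticePoint w ∈ Metric.ball (latticePoint (a k)) ρ
    · obtain ⟨k, hk⟩ := hex
      rw [key w k hk, Equiv.swap_apply_of_ne_of_ne (hwk k).1 (hwk k).2]
    · push Not at hex
      exact hG2 _ hex

/-- An injective renumbering of lattice points onto fresh lattice points with bounded displacement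
is realised by a bi-Lipschitz homeomorphism. -/
theorem exists_isBiLip_renumber {d : ℕ} (hd : 2 ≤ d) {ι : Type*} {a b : ι → Fin d → ℤ}
    (ha : Injective a) (hb : Injective b) (hab : ∀ i j, a i ≠ b j) {M : ℕ}
    (hM : ∀ i k, |b i k - a i k| ≤ M) :
    ∃ (K : ℝ≥0) (T : (Fin d → ℝ) ≃ (Fin d → ℝ)), IsBiLip K T ∧
      ∀ i, T (latticePoint (a i)) = latticePoint (b i) := by
  classical
  obtain ⟨K, ρ, hswap⟩ := exists_uniform_latticeSwap hd M
  choose T hT hw hx using fun i => hswap (b i - a i) (hM i)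
  obtain ⟨m, hm⟩ := exists_nat_gt (2 * ρ)
  have hm1 : (2 * ρ) ≤ ((m + 1 : ℕ) : ℝ) := by
    push_cast
    linarith
  set col : ι → Fin d → ZMod (m + 1) := fun i k => (a i k : ZMod (m + 1)) with hcol
  have hsep : ∀ i j, i ≠ j → col i = col j → 2 * ρ ≤ ‖latticePoint (a i) - latticePoint (a j)‖ := by
    intro i j hij hc
    obtain ⟨k, hk⟩ := Function.ne_iff.1 (ha.ne hij)
    refine norm_latticePoint_sub_ge k (hm1.trans ?_)
    have h1 : ((m + 1 : ℕ) : ℤ) ∣ a i k - a j k :=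
      (ZMod.intCast_eq_intCast_iff_dvd_sub _ _ _).1 (congrFun hc k).symm
    have h2 := Int.le_of_dvd (abs_pos.2 (sub_ne_zero.2 hk)) ((dvd_abs _ _).2 h1)
    exact_mod_cast h2
  have main : ∀ S : Finset (Fin d → ZMod (m + 1)), ∃ (K : ℝ≥0) (Ψ : (Fin d → ℝ) ≃ (Fin d → ℝ)),
      IsBiLip K Ψ ∧ ∀ i, Ψ (latticePoint (a i)) =
        latticePoint (if col i ∈ S then b i else a i) := by
    intro S
    induction S using Finset.induction_on with
    | empty => exact ⟨1, Equiv.refl _, IsBiLip.refl, fun i => by simp⟩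
    | insert c S hc ih =>
      obtain ⟨K', Ψ, hΨ, hΨa⟩ := ih
      obtain ⟨G, hG, hG1, hG2⟩ := exists_move_sparse (ι := {i // col i = c})
        (T := fun i => T i) (a := fun i => a i) (b := fun i => b i) (fun i => hT i)
        (fun i => hw i) (fun i => hx i)
        (fun i j hij => hsep i j (fun h => hij (Subtype.ext h)) (i.2.trans j.2.symm))
      refine ⟨_, Ψ.trans G, hΨ.trans hG, fun i => ?_⟩
      rw [Equiv.trans_apply, hΨa]
      by_cases hi : col i = c
      · rw [if_neg (hi ▸ hc), if_pos (hi ▸ Finset.mem_insert_self _ _)]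
        exact hG1 ⟨i, hi⟩
      · have h1 : col i ∈ insert c S ↔ col i ∈ S := by simp [hi]
        simp only [h1]
        refine hG2 _ fun j => ?_
        have hji : (j : ι) ≠ i := fun h => hi (h ▸ j.2)
        split_ifs
        · exact ⟨(hab _ _).symm, fun h => hji (hb h).symm⟩
        · exact ⟨fun h => hji (ha h).symm, hab _ _⟩
  obtain ⟨K', Ψ, hΨ, hΨa⟩ := main Finset.univ
  exact ⟨K', Ψ, hΨ, fun i => by rw [hΨa, if_pos (Finset.mem_univ _)]⟩

/-- Points of a separated family can be displaced slightly by a bi-Lipschitz homeomorphism. -/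
theorem exists_isBiLip_perturb {E ι : Type*} [NormedAddCommGroup E] [NormedSpace ℝ E]
    [CompleteSpace E] {r δ : ℝ} {x q : ι → E} (hr : 0 < r)
    (hx : ∀ i j, i ≠ j → r ≤ dist (x i) (x j)) (hδ : δ ≤ r / 4) (hq : ∀ i, ‖q i - x i‖ ≤ δ) :
    ∃ (K : ℝ≥0) (G : E ≃ E), IsBiLip K G ∧ ∀ i, G (x i) = q i := by
  have hbump : ∀ i, ∃ e : E ≃ E,
      (∀ y, e y = y + max 0 (1 - ‖y - x i‖ / (r / 2)) • (q i - x i)) ∧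
        IsBiLip (1 + 2 * (1 / 2 : ℝ≥0)) e := by
    intro i
    refine exists_equiv_id_add (η := 1 / 2) (by norm_num) (LipschitzWith.of_dist_le_mul
      fun y z => ?_)
    rw [dist_eq_norm, ← sub_smul, norm_smul]
    have h1 : ‖max 0 (1 - ‖y - x i‖ / (r / 2)) - max 0 (1 - ‖z - x i‖ / (r / 2))‖ ≤
        dist y z / (r / 2) := by
      rw [Real.norm_eq_abs]
      refine (abs_max_sub_max_le_max _ _ _ _).trans ?_
      rw [sub_self, abs_zero, max_eq_right (abs_nonneg _),
        show 1 - ‖y - x i‖ / (r / 2) - (1 - ‖z - x i‖ / (r / 2)) =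
          (‖z - x i‖ - ‖y - x i‖) / (r / 2) by ring, abs_div, abs_of_pos (half_pos hr)]
      gcongr
      refine (abs_norm_sub_norm_le _ _).trans ?_
      rw [sub_sub_sub_cancel_right, ← dist_eq_norm, dist_comm]
    calc _ ≤ dist y z / (r / 2) * (r / 4) :=
          mul_le_mul h1 ((hq i).trans hδ) (norm_nonneg _) (by positivity)
      _ = _ := by
          push_cast
          field_simp
          ring
  choose e he hbi using hbump
  obtain ⟨G, hG, hG1, -⟩ := exists_isBiLip_glue (A := fun i => Metric.ball (x i) (r / 2))
    (fun i j y hi hj => by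
      by_contra hne
      have h1 := hx i j hne
      have h2 := dist_triangle_left (x i) (x j) y
      rw [Metric.mem_ball] at hi hj
      linarith) hbi
    (fun i y hy => by
      rw [Metric.mem_ball, not_lt, dist_eq_norm, ← one_le_div (half_pos hr)] at hy
      rw [he, max_eq_left (by linarith), zero_smul, add_zero])
  refine ⟨_, G, hG, fun i => ?_⟩
  rw [hG1 i _ (Metric.mem_ball_self (half_pos hr)), he]
  simp

theorem exists_isBiLip_snap {d : ℕ} (hd : 2 ≤ d) {ι : Type*} {r M : ℝ} (hr : 0 < r)
    {x : ι → Fin d → ℝ} (hx : ∀ i j, i ≠ j → r ≤ dist (x i) (x j)) {b : ι → Fin d → ℤ}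
    (hb : Injective b) (hM : ∀ i, dist (x i) (latticePoint (b i)) ≤ M) :
    ∃ (K : ℝ≥0) (g : (Fin d → ℝ) ≃ (Fin d → ℝ)), IsBiLip K g ∧
      ∀ i, g (x i) = latticePoint (b i) := by
  classical
  obtain ⟨n, hn⟩ := exists_nat_gt (4 / r)
  set N : ℕ := n + 2 with hN
  have hN0 : (0 : ℝ) < N := by positivity
  have hNr : 1 / (N : ℝ) ≤ r / 4 := by
    rw [div_lt_iff₀ hr] at hn
    rw [div_le_div_iff₀ hN0 (by norm_num)]
    have : (n : ℝ) ≤ N := by simp [hN]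
    nlinarith
  let k₀ : Fin d := ⟨0, by omega⟩
  set w : ι → Fin d → ℤ := fun i k =>
    if k = k₀ ∧ (N : ℤ) ∣ ⌊(N : ℝ) * x i k⌋ then ⌊(N : ℝ) * x i k⌋ + 1 else ⌊(N : ℝ) * x i k⌋
    with hw
  have hw1 : ∀ i k, |(w i k : ℝ) - N * x i k| ≤ 1 := by
    intro i k
    have h1 := Int.floor_le ((N : ℝ) * x i k)
    have h2 := Int.lt_floor_add_one ((N : ℝ) * x i k)
    simp only [hw]
    rw [abs_le]
    split_ifs
    · push_cast
      constructor <;> linarith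
    · constructor <;> linarith
  have hw2 : ∀ i, ¬ (N : ℤ) ∣ w i k₀ := by
    intro i
    simp only [hw, true_and]
    split_ifs with h
    · intro h'
      have h1 := (Int.dvd_add_right h).1 h'
      have h2 := Int.le_of_dvd one_pos h1
      rw [hN] at h2
      push_cast at h2
      omega
    · exact h
  set q : ι → Fin d → ℝ := fun i => (1 / (N : ℝ)) • latticePoint (w i) with hq
  have hqx : ∀ i, ‖q i - x i‖ ≤ 1 / N := by
    intro i
    refine (pi_norm_le_iff_of_nonneg (by positivity)).2 fun k => ?_
    have h1 : (q i - x i) k = ((w i k : ℝ) - N * x i k) / N := by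
      simp only [hq, latticePoint, Pi.sub_apply, Pi.smul_apply, smul_eq_mul]
      field_simp
    rw [h1, Real.norm_eq_abs, abs_div, abs_of_pos hN0]
    gcongr
    exact hw1 i k
  have hwinj : Injective w := by
    intro i j hij
    by_contra hne
    have h1 := hx i j hne
    have h2 : q i = q j := by simp only [hq, hij]
    have h3 := hqx i
    have h4 := hqx j
    rw [← dist_eq_norm] at h3 h4
    rw [h2] at h3
    have h5 := dist_triangle_left (x i) (x j) (q j)
    linarith
  have hNb : Injective fun i k => (N : ℤ) * b i k := by
    intro i j hij
    refine hb (funext fun k => ?_)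
    have h1 := congrFun hij k
    have h2 : (N : ℤ) ≠ 0 := by
      rw [hN]
      positivity
    exact mul_left_cancel₀ h2 h1
  obtain ⟨M', hM'⟩ := exists_nat_ge ((N : ℝ) * M + 1)
  have hbound : ∀ i k, |(N : ℤ) * b i k - w i k| ≤ M' := by
    intro i k
    have h1 := (dist_le_pi_dist (x i) (latticePoint (b i)) k).trans (hM i)
    rw [Real.dist_eq] at h1
    simp only [latticePoint] at h1
    have h2 := hw1 i k
    have h3 : |((N : ℝ) * b i k - w i k)| ≤ M' := by
      rw [abs_le] at h1 h2 ⊢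
      constructor <;> nlinarith
    exact_mod_cast h3
  obtain ⟨K₁, G, hG, hGx⟩ := exists_isBiLip_perturb hr hx hNr hqx
  obtain ⟨K₂, e, he, hex⟩ := exists_isBiLip_smul (E := Fin d → ℝ) hN0
  obtain ⟨K₃, T, hT, hTw⟩ := exists_isBiLip_renumber hd hwinj hNb
    (fun i j h => hw2 i (h ▸ dvd_mul_right _ _)) hbound
  refine ⟨_, ((G.trans e).trans T).trans e.symm, ((hG.trans he).trans hT).trans he.symm,
    fun i => ?_⟩
  simp only [Equiv.trans_apply]
  have h1 : e (q i) = latticePoint (w i) := by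
    rw [hex, hq, smul_smul, mul_one_div_cancel hN0.ne', one_smul]
  rw [hGx, h1, hTw, Equiv.symm_apply_eq, hex]
  funext k
  simp [latticePoint]

/-- The piecewise linear interpolation of a sequence indexed by the integers. -/
noncomputable def intInterp (x : ℤ → ℝ) (t : ℝ) : ℝ :=
  x ⌊t⌋ + Int.fract t * (x (⌊t⌋ + 1) - x ⌊t⌋)

theorem monotone_intInterp {x : ℤ → ℝ} (hx : Monotone x) : Monotone (intInterp x) := by
  intro t s hts
  have hgap : ∀ n, 0 ≤ x (n + 1) - x n := fun n => sub_nonneg.2 (hx (by omega))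
  have ht0 := Int.fract_nonneg t
  have ht1 := (Int.fract_lt_one t).le
  have hs0 := Int.fract_nonneg s
  unfold intInterp
  rcases (Int.floor_mono hts).eq_or_lt with h | h
  · have h1 : Int.fract t ≤ Int.fract s := by
      unfold Int.fract
      rw [h]
      linarith
    rw [h]
    nlinarith [hgap ⌊s⌋]
  · have h1 : x (⌊t⌋ + 1) ≤ x ⌊s⌋ := hx h
    nlinarith [hgap ⌊s⌋, hgap ⌊t⌋]

theorem intInterp_sub (x y : ℤ → ℝ) (t : ℝ) :
    intInterp (fun n => x n - y n) t = intInterp x t - intInterp y t := by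
  unfold intInterp
  ring

theorem intInterp_mul_intCast (c t : ℝ) : intInterp (fun n => c * n) t = c * t := by
  unfold intInterp
  push_cast
  linear_combination c * Int.floor_add_fract t

theorem intInterp_intCast (x : ℤ → ℝ) (n : ℤ) : intInterp x n = x n := by
  simp [intInterp]

theorem exists_isBiLip_of_slope {f : ℝ → ℝ} {m M : ℝ} (hm : 0 < m)
    (h : ∀ t s, t ≤ s → m * (s - t) ≤ f s - f t ∧ f s - f t ≤ M * (s - t)) :
    ∃ (K : ℝ≥0) (e : ℝ ≃ ℝ), IsBiLip K e ∧ ∀ x, e x = f x := by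
  have hM : 0 ≤ M := by
    have := h 0 1 zero_le_one
    linarith
  have habs : ∀ t s, m * dist t s ≤ dist (f t) (f s) ∧ dist (f t) (f s) ≤ M * dist t s := by
    have hle : ∀ t s, t ≤ s → m * dist t s ≤ dist (f t) (f s) ∧
        dist (f t) (f s) ≤ M * dist t s := by
      intro t s hts
      have h1 := h t s hts
      have h2 : 0 ≤ f s - f t := le_trans (mul_nonneg hm.le (sub_nonneg.2 hts)) h1.1
      rw [dist_comm t, dist_comm (f t), Real.dist_eq, Real.dist_eq,
        abs_of_nonneg (sub_nonneg.2 hts), abs_of_nonneg h2]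
      exact h1
    intro t s
    rcases le_total t s with hts | hts
    · exact hle t s hts
    · rw [dist_comm t, dist_comm (f t)]
      exact hle s t hts
  have hlip : LipschitzWith M.toNNReal f := LipschitzWith.of_dist_le_mul fun t s => by
    rw [Real.coe_toNNReal _ hM]
    exact (habs t s).2
  have hinj : Injective f := fun t s hts => by
    have := (habs t s).1
    rw [hts, dist_self] at this
    exact dist_le_zero.1 (by nlinarith [dist_nonneg (x := t) (y := s)])
  have hsurj : Surjective f := by
    intro p
    refine mem_range_of_exists_le_of_exists_ge hlip.continuous
      ⟨min 0 ((p - f 0) / m), ?_⟩ ⟨max 0 ((p - f 0) / m), ?_⟩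
    · have h1 := (h _ 0 (min_le_left 0 ((p - f 0) / m))).1
      have h2 : m * min 0 ((p - f 0) / m) ≤ p - f 0 := by
        refine (mul_le_mul_of_nonneg_left (min_le_right _ _) hm.le).trans_eq ?_
        field_simp
      linarith
    · have h1 := (h 0 _ (le_max_left 0 ((p - f 0) / m))).1
      have h2 : p - f 0 ≤ m * max 0 ((p - f 0) / m) := by
        refine Eq.trans_le ?_ (mul_le_mul_of_nonneg_left (le_max_right _ _) hm.le)
        field_simp
      linarith
  refine ⟨max M.toNNReal m⁻¹.toNNReal, Equiv.ofBijective f ⟨hinj, hsurj⟩,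
    ⟨hlip.weaken (le_max_left _ _), LipschitzWith.weaken ?_ (le_max_right _ _)⟩, fun x => rfl⟩
  refine LipschitzWith.of_dist_le_mul fun y z => ?_
  rw [Real.coe_toNNReal _ (inv_pos.2 hm).le]
  obtain ⟨t, rfl⟩ := (Equiv.ofBijective f ⟨hinj, hsurj⟩).surjective y
  obtain ⟨s, rfl⟩ := (Equiv.ofBijective f ⟨hinj, hsurj⟩).surjective z
  rw [Equiv.symm_apply_apply, Equiv.symm_apply_apply, ← div_eq_inv_mul, le_div_iff₀ hm, mul_comm]
  exact (habs t s).1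

/-- A Delone subset of the line is the range of an increasing sequence. -/
theorem exists_strictMono_range_eq {S : Set ℝ} {r R : ℝ} (hr : 0 < r)
    (hS : ∀ x ∈ S, ∀ y ∈ S, x ≠ y → r ≤ dist x y) (hR : ∀ x, ∃ y ∈ S, dist x y ≤ R) :
    ∃ x : ℤ → ℝ, StrictMono x ∧ range x = S := by
  have hfin : ∀ a b : S, (Icc a b).Finite := by
    intro a b
    refine Set.Finite.of_injOn (f := fun y : S => ⌊(y : ℝ) / r⌋)
      (t := Icc ⌊(a : ℝ) / r⌋ ⌊(b : ℝ) / r⌋) (fun y hy => ?_) (fun y _ z _ hyz => ?_)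
      (Set.finite_Icc _ _)
    · have h1 : (a : ℝ) ≤ y := hy.1
      have h2 : (y : ℝ) ≤ b := hy.2
      exact ⟨Int.floor_mono (by gcongr), Int.floor_mono (by gcongr)⟩
    · by_contra hne
      have h1 := hS y y.2 z z.2 fun h => hne (Subtype.ext h)
      have h2 := Int.abs_sub_lt_one_of_floor_eq_floor hyz
      rw [← sub_div, abs_div, abs_of_pos hr, div_lt_one hr] at h2
      rw [Real.dist_eq] at h1
      linarith
  let _ : LocallyFiniteOrder S := LocallyFiniteOrder.ofFiniteIcc hfin
  let _ : SuccOrder S := LinearLocallyFiniteOrder.succOrder S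
  let _ : PredOrder S := LinearLocallyFiniteOrder.predOrder S
  have hR0 : 0 ≤ R := by
    obtain ⟨y, -, hy⟩ := hR 0
    exact dist_nonneg.trans hy
  have hne : Nonempty S := by
    obtain ⟨y, hy, -⟩ := hR 0
    exact ⟨⟨y, hy⟩⟩
  have hmax : NoMaxOrder S := ⟨fun a => by
    obtain ⟨y, hy, h⟩ := hR (a + R + 1)
    refine ⟨⟨y, hy⟩, ?_⟩
    rw [Real.dist_eq, abs_le] at h
    change (a : ℝ) < y
    linarith⟩
  have hmin : NoMinOrder S := ⟨fun a => by
    obtain ⟨y, hy, h⟩ := hR (a - R - 1)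
    refine ⟨⟨y, hy⟩, ?_⟩
    rw [Real.dist_eq, abs_le] at h
    change y < (a : ℝ)
    linarith⟩
  refine ⟨fun n => (orderIsoIntOfLinearSuccPredArch (ι := S)).symm n,
    fun m n hmn => (orderIsoIntOfLinearSuccPredArch (ι := S)).symm.strictMono hmn, ?_⟩
  ext y
  constructor
  · rintro ⟨n, rfl⟩
    exact Subtype.coe_prop _
  · intro hy
    exact ⟨orderIsoIntOfLinearSuccPredArch (⟨y, hy⟩ : S), by simp⟩

theorem exists_isBiLip_image_range_intCast {S : Set ℝ} {r R : ℝ} (hr : 0 < r)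
    (hS : ∀ x ∈ S, ∀ y ∈ S, x ≠ y → r ≤ dist x y) (hR : ∀ x, ∃ y ∈ S, dist x y ≤ R) :
    ∃ (K : ℝ≥0) (e : ℝ ≃ ℝ), IsBiLip K e ∧ ∀ x, x ∈ S ↔ ∃ n : ℤ, e x = n := by
  obtain ⟨x, hx, hxS⟩ := exists_strictMono_range_eq hr hS hR
  have hmem : ∀ n, x n ∈ S := fun n => hxS ▸ mem_range_self n
  have hlow : ∀ n, r ≤ x (n + 1) - x n := by
    intro n
    have h1 := hx (show n < n + 1 by omega)
    have h2 := hS _ (hmem (n + 1)) _ (hmem n) h1.ne'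
    rwa [Real.dist_eq, abs_of_pos (sub_pos.2 h1)] at h2
  have hupp : ∀ n, x (n + 1) - x n ≤ 2 * R := by
    intro n
    obtain ⟨y, hy, h⟩ := hR ((x n + x (n + 1)) / 2)
    rw [← hxS] at hy
    obtain ⟨k, rfl⟩ := hy
    rw [Real.dist_eq, abs_le] at h
    rcases le_or_gt k n with hk | hk
    · have := hx.monotone hk
      linarith
    · have := hx.monotone (show n + 1 ≤ k from hk)
      linarith
  have hmono1 : Monotone fun n : ℤ => x n - r * n := monotone_int_of_le_succ fun n => by
    have := hlow n
    push_cast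
    linarith
  have hmono2 : Monotone fun n : ℤ => 2 * R * n - x n := monotone_int_of_le_succ fun n => by
    have := hupp n
    push_cast
    linarith
  obtain ⟨K, e, he, hex⟩ := exists_isBiLip_of_slope (f := intInterp x) (M := 2 * R) hr
    fun t s hts => by
      have h1 := monotone_intInterp hmono1 hts
      have h2 := monotone_intInterp hmono2 hts
      rw [intInterp_sub, intInterp_sub, intInterp_mul_intCast, intInterp_mul_intCast] at h1 h2
      constructor <;> linarith
  refine ⟨K, e.symm, he.symm, fun y => ?_⟩
  simp only [Equiv.symm_apply_eq, hex, intInterp_intCast]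
  rw [← hxS, mem_range]
  exact exists_congr fun n => eq_comm

theorem exists_isBiLip_lattice_one {D : Set (Fin 1 → ℝ)} {r R : ℝ} (hr : 0 < r)
    (hD : SeparatedBy r D) (hR : ∀ x, ∃ y ∈ D, dist x y ≤ R) :
    ∃ (K : ℝ≥0) (e : (Fin 1 → ℝ) ≃ (Fin 1 → ℝ)), IsBiLip K e ∧
      ∀ x, x ∈ D ↔ ∃ w, e x = latticePoint w := by
  let I : (Fin 1 → ℝ) ≃ᵢ ℝ := IsometryEquiv.funUnique _ _
  have hmemI : ∀ y, y ∈ I.symm ⁻¹' D ↔ I.symm y ∈ D := fun y => Iff.rfl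
  obtain ⟨K, e, he, hex⟩ := exists_isBiLip_image_range_intCast (S := I.symm ⁻¹' D) hr
    (fun x hx y hy hxy => by
      rw [← I.symm.isometry.dist_eq]
      exact hD _ hx _ hy fun h => hxy (I.symm.injective h))
    (fun x => by
      obtain ⟨y, hy, h⟩ := hR (I.symm x)
      refine ⟨I y, by rwa [hmemI, I.symm_apply_apply], ?_⟩
      rwa [← I.symm.isometry.dist_eq, I.symm_apply_apply])
  refine ⟨1 * (K * 1), (I.toEquiv.trans e).trans I.symm.toEquiv,
    ⟨I.symm.isometry.lipschitz.comp (he.1.comp I.isometry.lipschitz), ?_⟩, fun x => ?_⟩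
  · exact I.symm.isometry.lipschitz.comp (he.2.comp I.isometry.lipschitz)
  · have h1 := hex (I x)
    rw [hmemI, I.symm_apply_apply] at h1
    rw [h1]
    constructor
    · rintro ⟨n, hn⟩
      refine ⟨fun _ => n, ?_⟩
      change I.symm (e (I x)) = _
      rw [hn]
      rfl
    · rintro ⟨w, hw⟩
      refine ⟨w 0, ?_⟩
      change I.symm (e (I x)) = _ at hw
      exact congrFun hw 0

theorem exists_isBiLip_lattice {d : ℕ} (hd : 1 ≤ d) {r R C : ℝ} {D : Set (Fin d → ℝ)}
    (hr : 0 < r) (hD : SeparatedBy r D) (hR : ∀ x, ∃ y ∈ D, dist x y ≤ R)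
    (hC : CubeRepetitive C D) :
    ∃ (K : ℝ≥0) (e : (Fin d → ℝ) ≃ (Fin d → ℝ)), IsBiLip K e ∧
      ∀ x, x ∈ D ↔ ∃ w, e x = latticePoint w := by
  rcases hd.eq_or_lt with rfl | hd2
  · exact exists_isBiLip_lattice_one hr hD hR
  obtain ⟨K, f, φ, M, hf, hφ⟩ := exists_isBiLip_near_lattice hd hr hD hR hC
  have hK : (0 : ℝ) < K + 1 := by positivity
  obtain ⟨K', g, hg, hgφ⟩ := exists_isBiLip_snap hd2 (x := fun p : D => f p) (b := fun p => φ p)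
    (div_pos hr hK) (fun p q hpq => by
      have h1 := hD p p.2 q q.2 fun h => hpq (Subtype.ext h)
      have h2 := hf.2.dist_le_mul (f p) (f q)
      rw [Equiv.symm_apply_apply, Equiv.symm_apply_apply] at h2
      rw [div_le_iff₀ hK]
      nlinarith [dist_nonneg (x := f p) (y := f q)]) φ.injective hφ
  refine ⟨_, f.trans g, hf.trans hg, fun x => ⟨fun hx => ⟨φ ⟨x, hx⟩, hgφ ⟨x, hx⟩⟩, ?_⟩⟩
  rintro ⟨w, hw⟩
  have h1 := hgφ (φ.symm w)
  rw [Equiv.apply_symm_apply, ← hw, Equiv.trans_apply] at h1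
  rw [← f.injective (g.injective h1)]
  exact Subtype.coe_prop _

/-- **Main Theorem.** Every linearly repetitive Delone set in ℝ^d is rectifiable by a
bi-Lipschitz homeomorphism of the whole space, sending it onto the standard lattice ℤ^d. -/
theorem linearly_repetitive_delone_rectifiable_by_ambient_biLipschitz
    (d : ℕ) (hd : 1 ≤ d) (D : Set (EuclideanSpace ℝ (Fin d)))
    -- D is a Delone set:
    (r R : ℝ) (hr : 0 < r) (hR : 0 < R)
    (hUnifDisc : ∀ x ∈ D, ∀ y ∈ D, x ≠ y → r ≤ dist x y)
    (hRelDense : ∀ x : EuclideanSpace ℝ (Fin d), ∃ y ∈ D, dist x y ≤ R)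
    -- D is linearly repetitive:
    (C : ℝ) (hC : 1 ≤ C)
    (hLinRep : ∀ ρ : ℝ, 1 ≤ ρ → ∀ x y : EuclideanSpace ℝ (Fin d),
      ∃ t : EuclideanSpace ℝ (Fin d),
        (fun p => t + p) '' (D ∩ Metric.closedBall x ρ) = D ∩ Metric.closedBall (x + t) ρ ∧
        Metric.closedBall (x + t) ρ ⊆ Metric.closedBall y (C * ρ)) :
    -- conclusion: a bi-Lipschitz homeomorphism F of ℝ^d with F(D) = ℤ^d
    ∃ F : EuclideanSpace ℝ (Fin d) → EuclideanSpace ℝ (Fin d),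
      Function.Bijective F ∧
      (∃ K : ℝ, 1 ≤ K ∧ ∀ u v : EuclideanSpace ℝ (Fin d),
        (1 / K) * ‖u - v‖ ≤ ‖F u - F v‖ ∧ ‖F u - F v‖ ≤ K * ‖u - v‖) ∧
      F '' D = intLattice d := by
  let Φ : EuclideanSpace ℝ (Fin d) ≃L[ℝ] (Fin d → ℝ) := EuclideanSpace.equiv (Fin d) ℝ
  obtain ⟨A, hA⟩ : ∃ A : ℝ≥0, LipschitzWith A Φ := ⟨_, Φ.lipschitz⟩
  obtain ⟨B, hB1, hB⟩ : ∃ B : ℝ≥0, 1 ≤ B ∧ LipschitzWith B Φ.symm :=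
    ⟨_, le_max_left _ _, Φ.symm.lipschitz.weaken (le_max_right 1 _)⟩
  have hB1' : (1 : ℝ) ≤ B := hB1
  have hB0 : (0 : ℝ) < B := one_pos.trans_le hB1'
  have hsep : SeparatedBy (r / B) (Φ.symm ⁻¹' D) := by
    intro x hx y hy hxy
    rw [div_le_iff₀' hB0]
    exact (hUnifDisc _ hx _ hy fun h => hxy (Φ.symm.injective h)).trans (hB.dist_le_mul x y)
  have hdense : ∀ x, ∃ y ∈ Φ.symm ⁻¹' D, dist x y ≤ A * R := by
    intro x
    obtain ⟨y, hy, h⟩ := hRelDense (Φ.symm x)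
    refine ⟨Φ y, by rwa [mem_preimage, Φ.symm_apply_apply], ?_⟩
    have h1 := hA.dist_le_mul (Φ.symm x) y
    rw [Φ.apply_symm_apply] at h1
    exact h1.trans (mul_le_mul_of_nonneg_left h A.2)
  have hrep : CubeRepetitive (A * (C * B)) (Φ.symm ⁻¹' D) := by
    intro L hL y₀ y
    have hρ : 1 ≤ B * L := one_le_mul_of_one_le_of_one_le hB1' hL
    obtain ⟨t, ht, hsub⟩ := hLinRep (B * L) hρ (Φ.symm y₀) (Φ.symm y)
    refine ⟨Φ t, fun p hp => ?_, ?_⟩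
    · have h1 : dist p y₀ ≤ L := by
        refine (dist_pi_le_iff (zero_le_one.trans hL)).2 fun i => ?_
        have := mem_hbox.1 hp i
        rw [Real.dist_eq, abs_le]
        constructor <;> linarith [this.1, this.2]
      have h2 : dist (Φ.symm p) (Φ.symm y₀) ≤ B * L :=
        (hB.dist_le_mul _ _).trans (mul_le_mul_of_nonneg_left h1 hB0.le)
      simp only [mem_preimage, map_add, Φ.symm_apply_apply]
      constructor
      · intro hpD
        exact (ht.subset ⟨_, ⟨hpD, h2⟩, rfl⟩).1
      · intro hpD
        have h3 : t + Φ.symm p ∈ D ∩ Metric.closedBall (Φ.symm y₀ + t) (B * L) := by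
          refine ⟨hpD, ?_⟩
          rwa [Metric.mem_closedBall, add_comm, dist_add_right]
        obtain ⟨q, hq, hqe⟩ := ht.superset h3
        rw [← add_left_cancel hqe]
        exact hq.1
    · have h1 := hsub (Metric.mem_closedBall_self (zero_le_one.trans hρ))
      rw [Metric.mem_closedBall] at h1
      have h2 := hA.dist_le_mul (Φ.symm y₀ + t) (Φ.symm y)
      rw [map_add, Φ.apply_symm_apply, Φ.apply_symm_apply, add_comm] at h2
      calc _ ≤ _ := h2
        _ ≤ A * (C * (B * L)) := mul_le_mul_of_nonneg_left h1 A.2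
        _ = _ := by ring
  obtain ⟨K, e, he, heD⟩ := exists_isBiLip_lattice hd (div_pos hr hB0) hsep hdense hrep
  have hF : LipschitzWith (B * (K * A)) fun x => Φ.symm (e (Φ x)) := hB.comp (he.1.comp hA)
  have hG : LipschitzWith (B * (K * A)) fun x => Φ.symm (e.symm (Φ x)) := hB.comp (he.2.comp hA)
  have hGF : ∀ x, Φ.symm (e.symm (Φ (Φ.symm (e (Φ x))))) = x := fun x => by simp
  have hFG : ∀ x, Φ.symm (e (Φ (Φ.symm (e.symm (Φ x))))) = x := fun x => by simp
  have hlattice : ∀ x, x ∈ intLattice d ↔ ∃ w, Φ x = latticePoint w := by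
    intro x
    constructor
    · intro hx
      choose w hw using hx
      exact ⟨w, funext hw⟩
    · rintro ⟨w, hw⟩ i
      exact ⟨w i, congrFun hw i⟩
  have hDF : ∀ x, x ∈ D ↔ Φ.symm (e (Φ x)) ∈ intLattice d := by
    intro x
    rw [hlattice, Φ.apply_symm_apply, ← heD, mem_preimage, Φ.symm_apply_apply]
  refine ⟨fun x => Φ.symm (e (Φ x)),
    ⟨LeftInverse.injective (g := fun x => Φ.symm (e.symm (Φ x))) hGF, fun y => ⟨_, hFG y⟩⟩,
    ⟨max 1 (B * (K * A) : ℝ≥0), le_max_left _ _, fun u v => ⟨?_, ?_⟩⟩, ?_⟩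
  · have h1 := hG.dist_le_mul (Φ.symm (e (Φ u))) (Φ.symm (e (Φ v)))
    rw [hGF, hGF, dist_eq_norm, dist_eq_norm] at h1
    rw [one_div, ← div_eq_inv_mul, div_le_iff₀ (one_pos.trans_le (le_max_left _ _)), mul_comm]
    exact h1.trans (mul_le_mul_of_nonneg_right (le_max_right _ _) (norm_nonneg _))
  · have h1 := hF.dist_le_mul u v
    rw [dist_eq_norm, dist_eq_norm] at h1
    exact h1.trans (mul_le_mul_of_nonneg_right (le_max_right _ _) (norm_nonneg _))
  · ext y
    constructor
    · rintro ⟨x, hx, rfl⟩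
      exact (hDF x).1 hx
    · intro hy
      refine ⟨Φ.symm (e.symm (Φ y)), (hDF _).2 ?_, hFG y⟩
      rwa [hFG]
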